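/- Let K be an algebraically closed field of characteristic 2. Two non-degenerate form modules (V,T) and (V′,T′) over K are isomorphic if and only if T and T′ have the same Jordan type (the same multiset of Jordan block sizes) and the index functions χ(V,T) and χ(V′,T′) are equal as functions ℕ → ℤ. -/

import Mathlib

open Module Finset

/-- The radical `V^⊥ = {v | ⟨v,w⟩ = 0 for all w}` of the polar form of `Q`. -/
def QuadraticForm.polarRadical {F V : Type*} [Field F] [AddCommGroup V] [Module F V]
    (Q : QuadraticForm F V) : Submodule F V :=
  LinearMap.ker (QuadraticMap.polarBilin Q)

/-- A quadratic space `(V, Q)` (in characteristic 2) is non-degenerate if `V ≠ 0`,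
`dim V^⊥ ≤ 1` and `Q(v) ≠ 0` for every nonzero `v ∈ V^⊥`. -/
def QuadraticForm.IsNondegenerateFormSpace {F V : Type*} [Field F] [AddCommGroup V] [Module F V]
    (Q : QuadraticForm F V) : Prop :=
  Nontrivial V ∧ Module.finrank F Q.polarRadical ≤ 1 ∧
    ∀ v ∈ Q.polarRadical, v ≠ 0 → Q v ≠ 0

/-- Membership in the orthogonal Lie algebra
`𝔬(V) = {x ∈ End(V) | ⟨xv, v⟩ = 0 ∀ v, tr x = 0}`. -/
def QuadraticForm.mem_oLie {F V : Type*} [Field F] [AddCommGroup V] [Module F V]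
    (Q : QuadraticForm F V) (x : Module.End F V) : Prop :=
  (∀ v : V, QuadraticMap.polar Q (x v) v = 0) ∧ LinearMap.trace F V x = 0


/-- The index function `χ(V,T) : ℕ → ℕ`,
`χ(m) = min {j ≥ 0 | Q(T^j v) = 0 for all v with T^m v = 0}`. -/
noncomputable def QuadraticForm.indexChi {F V : Type*} [Field F] [AddCommGroup V] [Module F V]
    (Q : QuadraticForm F V) (T : Module.End F V) (m : ℕ) : ℕ :=
  sInf {j : ℕ | ∀ v : V, (T ^ m) v = 0 → Q ((T ^ j) v) = 0}

set_option linter.unusedSectionVars false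

namespace FormMod

/-- The polar bilinear form. -/
def Bf {K V : Type*} [Field K] [AddCommGroup V] [Module K V]
    (Q : QuadraticForm K V) : V →ₗ[K] V →ₗ[K] K := QuadraticMap.polarBilin Q

section basic

variable {K V : Type*} [Field K] [AddCommGroup V] [Module K V]
  {Q : QuadraticForm K V} {T : Module.End K V}

lemma Q_add (x y : V) : Q (x + y) = Q x + Q y + Bf Q x y := by
  simp [Bf, QuadraticMap.polar]

lemma Q_smul (a : K) (x : V) : Q (a • x) = a ^ 2 * Q x := by
  rw [QuadraticMap.map_smul]; simp [pow_two]

lemma Bf_comm (x y : V) : Bf Q x y = Bf Q y x := by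
  simp [Bf, QuadraticMap.polar_comm]

lemma Bf_self [CharP K 2] (x : V) : Bf Q x x = 0 := by
  simp [Bf, CharTwo.two_eq_zero]

/-- The operator is "alternating" for the polar form. -/
def Alt (Q : QuadraticForm K V) (T : Module.End K V) : Prop := ∀ v, Bf Q (T v) v = 0

variable [CharP K 2]

lemma Bf_adj (h : Alt Q T) (x y : V) : Bf Q (T x) y = Bf Q x (T y) := by
  have h1 := h (x + y)
  have h2 := h x
  have h3 := h y
  simp only [map_add, LinearMap.add_apply] at h1
  rw [h2, h3, zero_add, add_zero, Bf_comm (T y) x] at h1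
  have := CharTwo.add_eq_zero.mp h1
  exact this.symm ▸ rfl

lemma pow_succ_app (k : ℕ) (x : V) : (T ^ (k + 1)) x = (T ^ k) (T x) := by
  rw [pow_succ]; rfl

lemma pow_succ_app' (k : ℕ) (x : V) : (T ^ (k + 1)) x = T ((T ^ k) x) := by
  rw [pow_succ']; rfl

lemma pow_add_app (k j : ℕ) (x : V) : (T ^ k) ((T ^ j) x) = (T ^ (k + j)) x := by
  rw [pow_add]; rfl

lemma pow_zero_app (x : V) : (T ^ 0) x = x := by simp

lemma pow_app_eq_zero {k j : ℕ} {x : V} (h : (T ^ k) x = 0) (hkj : k ≤ j) : (T ^ j) x = 0 := by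
  obtain ⟨d, rfl⟩ := Nat.exists_eq_add_of_le' hkj
  rw [← pow_add_app, h, map_zero]

lemma Bf_adj_pow (h : Alt Q T) (k : ℕ) (x y : V) : Bf Q ((T ^ k) x) y = Bf Q x ((T ^ k) y) := by
  induction k generalizing x y with
  | zero => simp
  | succ k ih => rw [pow_succ_app, ih, Bf_adj h, pow_succ_app']

lemma Bf_pow_pow (h : Alt Q T) (k j : ℕ) (x y : V) :
    Bf Q ((T ^ k) x) ((T ^ j) y) = Bf Q ((T ^ (k + j)) x) y := by
  rw [← Bf_adj_pow h, pow_add_app, add_comm]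

lemma Bf_pow_comm (h : Alt Q T) (k : ℕ) (x y : V) :
    Bf Q ((T ^ k) x) y = Bf Q ((T ^ k) y) x := by
  rw [Bf_adj_pow h, Bf_comm]

lemma Bf_pow_self (h : Alt Q T) (k : ℕ) (x : V) : Bf Q ((T ^ k) x) x = 0 := by
  rcases Nat.even_or_odd' k with ⟨c, rfl | rfl⟩
  · rw [two_mul, ← Bf_pow_pow h, Bf_self]
  · have : (T ^ (2 * c + 1)) x = (T ^ c) (T ((T ^ c) x)) := by
      rw [← pow_succ_app, pow_add_app]; congr 2; ring
    rw [this, Bf_adj_pow h, h]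

/-- `∑_{k<N} a_k T^k x`. -/
def PT (T : Module.End K V) (N : ℕ) (a : ℕ → K) (x : V) : V :=
  ∑ k ∈ range N, a k • (T ^ k) x

lemma T_PT (i N : ℕ) (a : ℕ → K) (x : V) :
    (T ^ i) (PT T N a x) = ∑ k ∈ range N, a k • (T ^ (i + k)) x := by
  simp [PT, map_sum, pow_add_app]

lemma T_PT' (i N : ℕ) (a : ℕ → K) (x : V) :
    (T ^ i) (PT T N a x) = PT T N a ((T ^ i) x) := by
  rw [T_PT, PT]
  refine Finset.sum_congr rfl fun k _ => ?_
  rw [pow_add_app, add_comm]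

lemma PT_zero (N : ℕ) (a : ℕ → K) : PT T N a 0 = 0 := by simp [PT]

lemma Bf_PT (i N : ℕ) (a : ℕ → K) (x y : V) :
    Bf Q ((T ^ i) (PT T N a x)) y = ∑ k ∈ range N, a k * Bf Q ((T ^ (i + k)) x) y := by
  simp [T_PT, map_sum, LinearMap.sum_apply]

lemma Bf_PT' (h : Alt Q T) (i N : ℕ) (a : ℕ → K) (x y : V) :
    Bf Q ((T ^ i) y) (PT T N a x) = ∑ k ∈ range N, a k * Bf Q ((T ^ (i + k)) y) x := by
  rw [Bf_pow_comm h, Bf_PT]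
  exact Finset.sum_congr rfl fun k _ => by rw [Bf_pow_comm h]

lemma Bf_PT_self (h : Alt Q T) (i N : ℕ) (a : ℕ → K) (x : V) :
    Bf Q ((T ^ i) (PT T N a x)) x = 0 := by
  rw [Bf_PT]
  exact Finset.sum_eq_zero fun k _ => by rw [Bf_pow_self h, mul_zero]

lemma Bf_PT_PT_self (h : Alt Q T) (i N M : ℕ) (a b : ℕ → K) (x : V) :
    Bf Q ((T ^ i) (PT T N a x)) (PT T M b x) = 0 := by
  rw [Bf_PT' h]
  exact Finset.sum_eq_zero fun k _ => by rw [Bf_PT_self h, mul_zero]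

lemma Q_PT (h : Alt Q T) (i N : ℕ) (a : ℕ → K) (x : V) :
    Q ((T ^ i) (PT T N a x)) = ∑ k ∈ range N, a k ^ 2 * Q ((T ^ (i + k)) x) := by
  rw [T_PT]
  induction N with
  | zero => simp
  | succ N ih =>
    rw [Finset.sum_range_succ, Finset.sum_range_succ, Q_add, ih, Q_smul]
    have : Bf Q (∑ k ∈ range N, a k • (T ^ (i + k)) x) (a N • (T ^ (i + N)) x) = 0 := by
      rw [← T_PT, map_smul, Bf_pow_pow h, Bf_PT_self h, smul_zero]
    rw [this, add_zero]

lemma PT_mem {N : ℕ} {a : ℕ → K} {x : V} {U : Submodule K V} (hU : ∀ x ∈ U, T x ∈ U)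
    (hx : x ∈ U) : PT T N a x ∈ U := by
  have : ∀ k, (T ^ k) x ∈ U := by
    intro k
    induction k with
    | zero => simpa
    | succ k ih => rw [pow_succ_app']; exact hU _ ih
  exact Submodule.sum_mem _ fun k _ => Submodule.smul_mem _ _ (this k)

/-- Inverting a truncated power series. -/
lemma exists_inv (h : ℕ → K) (m : ℕ) (hm : h m ≠ 0) (h0 : ∀ k, m < k → h k = 0) :
    ∃ c : ℕ → K, c 0 = (h m)⁻¹ ∧ ∀ N, m < N → ∀ i,
      ∑ k ∈ range N, c k * h (i + k) = if i = m then 1 else 0 := by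
  let s : PowerSeries K := PowerSeries.mk fun k => if k ≤ m then h (m - k) else 0
  have hs0 : PowerSeries.constantCoeff s = h m := by
    simp [s, ← PowerSeries.coeff_zero_eq_constantCoeff_apply]
  have hs : PowerSeries.constantCoeff s ≠ 0 := by rwa [hs0]
  have hinv := PowerSeries.inv_mul_cancel s hs
  refine ⟨fun k => PowerSeries.coeff k s⁻¹, ?_, ?_⟩
  · show PowerSeries.coeff 0 s⁻¹ = _
    rw [PowerSeries.coeff_zero_eq_constantCoeff_apply, PowerSeries.constantCoeff_inv, hs0]
  · intro N hN i
    by_cases hi : i ≤ m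
    · have := congrArg (PowerSeries.coeff (m - i)) hinv
      rw [PowerSeries.coeff_mul, Finset.Nat.sum_antidiagonal_eq_sum_range_succ_mk,
        PowerSeries.coeff_one] at this
      have e : (m - i = 0) = (i = m) := by apply propext; omega
      rw [if_congr (iff_of_eq e) rfl rfl] at this
      rw [← this]
      symm
      apply Finset.sum_subset_zero_on_sdiff
      · intro k hk; simp at hk ⊢; omega
      · intro k hk; simp at hk
        rw [h0 _ (by omega), mul_zero]
      · intro k hk; simp at hk
        simp only [s, PowerSeries.coeff_mk]
        rw [if_pos (by omega)]
        congr 2; omega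
    · rw [if_neg (by omega)]
      exact Finset.sum_eq_zero fun k _ => by rw [h0 _ (by omega), mul_zero]

end basic

section closed

variable {K V : Type*} [Field K] [AddCommGroup V] [Module K V] [IsAlgClosed K] [CharP K 2]
  {Q : QuadraticForm K V} {T : Module.End K V}

lemma exists_sq (x : K) : ∃ y : K, y ^ 2 = x := IsAlgClosed.exists_pow_nat_eq x (by norm_num)

lemma exists_as (x : K) : ∃ y : K, y ^ 2 + y = x := by
  have hd : (Polynomial.X ^ 2 + Polynomial.X - Polynomial.C x : Polynomial K).degree ≠ 0 := by
    have : (Polynomial.X ^ 2 + Polynomial.X - Polynomial.C x : Polynomial K).degree = 2 := by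
      compute_degree!
    rw [this]; norm_num
  obtain ⟨y, hy⟩ := IsAlgClosed.exists_root _ hd
  refine ⟨y, ?_⟩
  simp [Polynomial.IsRoot] at hy
  linear_combination hy

/-- The recursion solving `a_j^2 + a_{2j-f} = b_j`. -/
noncomputable def solA (f : ℤ) (b : ℕ → K) (s r : K → K) (k : ℕ) : K :=
  if h1 : (k : ℤ) < f then
    s (b k + if h2 : f ≤ 2 * k then solA f b s r (2 * (k : ℤ) - f).toNat else 0)
  else if h3 : (k : ℤ) = f then r (b k)
  else if h4 : ((k : ℤ) + f) % 2 = 0 ∧ -1 ≤ f then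
    b (((k : ℤ) + f) / 2).toNat + solA f b s r (((k : ℤ) + f) / 2).toNat ^ 2
  else 0
termination_by k
decreasing_by all_goals omega

lemma exists_sol (f : ℤ) (hf : -1 ≤ f) (b : ℕ → K) :
    ∃ a : ℕ → K, ∀ j : ℕ, a j ^ 2 + (if f ≤ 2 * j then a (2 * (j : ℤ) - f).toNat else 0) = b j := by
  choose s hs using exists_sq (K := K)
  choose r hr using exists_as (K := K)
  refine ⟨solA f b s r, fun j => ?_⟩
  rcases lt_trichotomy (j : ℤ) f with h | h | h
  · rw [solA, dif_pos h, hs]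
    simp only [dite_eq_ite]
    rw [add_assoc, CharTwo.add_self_eq_zero, add_zero]
  · rw [if_pos (by omega)]
    have : (2 * (j : ℤ) - f).toNat = j := by omega
    rw [this, solA, dif_neg (by omega), dif_pos h, hr]
  · rw [if_pos (by omega)]
    have : solA f b s r (2 * (j : ℤ) - f).toNat = b j + solA f b s r j ^ 2 := by
      rw [solA]
      have e : (((2 * (j : ℤ) - f).toNat : ℤ) + f) = 2 * j := by omega
      rw [dif_neg (by omega), dif_neg (by omega), dif_pos (by omega), e]
      have e2 : (2 * (j : ℤ) / 2).toNat = j := by omega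
      rw [e2]
    rw [this, add_comm (b j), ← add_assoc, CharTwo.add_self_eq_zero, zero_add]

/-- Normalising a plane. -/
lemma plane (hA : Alt Q T) (v w : V) (p n l : ℕ)
    (hp : p = n ∨ p = n + 1) (hl : p = n + 1 → l = p) (hl1 : 1 ≤ l) (hnl : n ≤ 2 * l)
    (tv : (T ^ p) v = 0) (tw : (T ^ n) w = 0)
    (hB : 1 ≤ n → Bf Q ((T ^ (n - 1)) v) w ≠ 0) (hB0 : n = 0 → w = 0)
    (hQ : Q ((T ^ (l - 1)) v) ≠ 0) (hQv : ∀ k, l ≤ k → Q ((T ^ k) v) = 0)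
    (hQw : ∀ k, l ≤ k → Q ((T ^ k) w) = 0) :
    ∃ v' w' : V, (T ^ p) v' = 0 ∧ (T ^ n) w' = 0 ∧
      (∀ k, Bf Q ((T ^ k) v') w' = if k + 1 = n then 1 else 0) ∧
      (∀ k, Q ((T ^ k) v') = if k + 1 = l then 1 else 0) ∧ (∀ k, Q ((T ^ k) w') = 0) ∧
      ∀ U : Submodule K V, (∀ x ∈ U, T x ∈ U) → v ∈ U → w ∈ U → v' ∈ U ∧ w' ∈ U := by
  -- step A
  obtain ⟨v1, tv1, Bv1, Qv1, Uv1⟩ : ∃ v1 : V, (T ^ p) v1 = 0 ∧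
      (1 ≤ n → Bf Q ((T ^ (n - 1)) v1) w ≠ 0) ∧
      (∀ k, Q ((T ^ k) v1) = if k + 1 = l then 1 else 0) ∧
      ∀ U : Submodule K V, (∀ x ∈ U, T x ∈ U) → v ∈ U → v1 ∈ U := by
    obtain ⟨c, hc0, hc⟩ := exists_inv (fun k => Q ((T ^ k) v)) (l - 1) hQ
      (fun k hk => hQv k (by omega))
    choose s hs using exists_sq (K := K)
    refine ⟨PT T (n + l) (fun k => s (c k)) v, ?_, ?_, ?_, ?_⟩
    · rw [T_PT', tv, PT_zero]
    · intro hn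
      rw [Bf_PT, Finset.sum_eq_single 0]
      · refine mul_ne_zero ?_ (hB hn)
        intro h0
        have := hs (c 0)
        rw [h0, hc0] at this
        exact inv_ne_zero hQ (by rw [← this]; simp)
      · intro k _ hk
        rw [Bf_pow_comm hA, pow_app_eq_zero tw (by omega)]; simp
      · intro h; simp at h; omega
    · intro k
      rw [Q_PT hA]
      simp only [hs]
      rw [hc (n + l) (by omega) k]
      exact if_congr (by omega) rfl rfl
    · intro U hU hv
      exact PT_mem hU hv
  -- step B
  obtain ⟨w1, tw1, Bw1, Qw1, Uw1⟩ : ∃ w1 : V, (T ^ n) w1 = 0 ∧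
      (∀ k, Bf Q ((T ^ k) v1) w1 = if k + 1 = n then 1 else 0) ∧
      (∀ k, l ≤ k → Q ((T ^ k) w1) = 0) ∧
      ∀ U : Submodule K V, (∀ x ∈ U, T x ∈ U) → w ∈ U → w1 ∈ U := by
    rcases Nat.eq_zero_or_pos n with hn | hn
    · refine ⟨w, tw, ?_, hQw, fun U _ h => h⟩
      intro k
      rw [hB0 hn, if_neg (by omega)]; simp
    · obtain ⟨c, hc0, hc⟩ := exists_inv (fun k => Bf Q ((T ^ k) v1) w) (n - 1) (Bv1 hn)
        (fun k hk => by rw [Bf_pow_comm hA, pow_app_eq_zero tw (by omega)]; simp)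
      refine ⟨PT T n c w, ?_, ?_, ?_, fun U hU h => PT_mem hU h⟩
      · rw [T_PT', tw, PT_zero]
      · intro k
        rw [Bf_PT' hA, hc n (by omega) k]
        exact if_congr (by omega) rfl rfl
      · intro k hk
        rw [Q_PT hA]
        exact Finset.sum_eq_zero fun j _ => by rw [hQw _ (by omega), mul_zero]
  -- step C
  obtain ⟨a, ha⟩ := exists_sol (2 * (l : ℤ) - n - 1) (by omega)
    (fun j => Q ((T ^ (l - 1 - j)) w1))
  refine ⟨v1, w1 + PT T (n + l) a v1, tv1, ?_, ?_, Qv1, ?_, ?_⟩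
  · rw [map_add, tw1, zero_add]
    rcases hp with rfl | hp
    · rw [T_PT', tv1, PT_zero]
    · have h0 := ha 0
      have hl' := hl hp
      rw [if_neg (by omega), hl', hp] at h0
      simp only [Nat.add_sub_cancel, Nat.sub_zero, tw1, add_zero, map_zero] at h0
      have h0' : a 0 = 0 := by simpa using h0
      rw [T_PT]
      refine Finset.sum_eq_zero fun k _ => ?_
      rcases Nat.eq_zero_or_pos k with rfl | hk
      · rw [h0', zero_smul]
      · rw [pow_app_eq_zero tv1 (by omega), smul_zero]
  · intro k
    rw [map_add, Bw1, Bf_PT' hA]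
    rw [Finset.sum_eq_zero, add_zero]
    intro j _
    rw [Bf_pow_self hA, mul_zero]
  · intro i
    rw [map_add, Q_add, Q_PT hA, Bf_comm, Bf_pow_pow hA, Bf_PT]
    simp only [Qv1, Bw1, mul_ite, mul_one, mul_zero]
    by_cases hi : l ≤ i
    · rw [Qw1 i hi, Finset.sum_eq_zero, Finset.sum_eq_zero]
      · simp
      · intro k _; rw [if_neg (by omega)]
      · intro k _; rw [if_neg (by omega)]
    · have h := ha (l - 1 - i)
      have e1 : l - 1 - (l - 1 - i) = i := by omega
      simp only [e1] at h
      rw [Finset.sum_eq_single (l - 1 - i)]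
      rotate_left
      · intro k _ hk; rw [if_neg (by omega)]
      · intro hk; simp at hk; omega
      rw [if_pos (by omega)]
      have h2 : (∑ k ∈ range (n + l), if i + i + k + 1 = n then a k else 0) =
          if 2 * (l : ℤ) - n - 1 ≤ 2 * ((l - 1 - i : ℕ) : ℤ) then
            a (2 * ((l - 1 - i : ℕ) : ℤ) - (2 * (l : ℤ) - n - 1)).toNat else 0 := by
        split_ifs with hc
        · rw [Finset.sum_eq_single (n - 1 - 2 * i)]
          · rw [if_pos (by omega)]; congr 1; omega
          · intro k _ hk; rw [if_neg (by omega)]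
          · intro hk; simp at hk; omega
        · refine Finset.sum_eq_zero fun k _ => ?_
          rw [if_neg (by omega)]
      rw [h2, add_assoc, h, CharTwo.add_self_eq_zero]
  · intro U hU hv hw
    exact ⟨Uv1 U hU hv, U.add_mem (Uw1 U hU hw) (PT_mem hU (Uv1 U hU hv))⟩

end closed

end FormMod

namespace FormMod

section fam

variable {K V : Type*} [Field K] [AddCommGroup V] [Module K V] [IsAlgClosed K] [CharP K 2]
  {Q : QuadraticForm K V} {T : Module.End K V}

/-- An orthogonal family of normalised blocks. -/
structure Fam (Q : QuadraticForm K V) (T : Module.End K V) {ι : Type} (v w : ι → V)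
    (p n l : ι → ℕ) : Prop where
  vv : ∀ i j k, i ≠ j → Bf Q ((T ^ k) (v i)) (v j) = 0
  ww : ∀ i j k, i ≠ j → Bf Q ((T ^ k) (w i)) (w j) = 0
  vw' : ∀ i j k, i ≠ j → Bf Q ((T ^ k) (v i)) (w j) = 0
  vw : ∀ i k, Bf Q ((T ^ k) (v i)) (w i) = if k + 1 = n i then 1 else 0
  Qv : ∀ i k, Q ((T ^ k) (v i)) = if k + 1 = l i then 1 else 0
  Qw : ∀ i k, Q ((T ^ k) (w i)) = 0
  tv : ∀ i, (T ^ (p i)) (v i) = 0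
  tw : ∀ i, (T ^ (n i)) (w i) = 0
  hp : ∀ i, p i = n i ∨ p i = n i + 1
  hl : ∀ i, p i = n i + 1 → l i = p i
  hp1 : ∀ i, 1 ≤ p i
  hl1 : ∀ i, 1 ≤ l i
  hnl : ∀ i, n i ≤ 2 * l i
  hD : ∀ i j, p i = n i + 1 → p j = n j + 1 → i = j

/-- The T-orthogonal of an element. -/
def perpT (Q : QuadraticForm K V) (T : Module.End K V) (z : V) : Submodule K V where
  carrier := {x | ∀ k, Bf Q ((T ^ k) x) z = 0}
  add_mem' := by
    intro a b ha hb k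
    simp [ha k, hb k]
  zero_mem' := by intro k; simp
  smul_mem' := by
    intro c a ha k
    simp [ha k]

lemma mem_perpT {z x : V} : x ∈ perpT Q T z ↔ ∀ k, Bf Q ((T ^ k) x) z = 0 := Iff.rfl

lemma perpT_stable (z : V) : ∀ x ∈ perpT Q T z, T x ∈ perpT Q T z := by
  intro x hx k
  rw [← pow_succ_app]; exact hx _

/-- The map `z ↦ ∑ ⟨T^(n-1-j) z, u⟩ T^j w`. -/
def cw (Q : QuadraticForm K V) (T : Module.End K V) (n : ℕ) (u w z : V) : V :=
  PT T n (fun j => Bf Q ((T ^ (n - 1 - j)) z) u) w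

lemma T_cw (hA : Alt Q T) {n : ℕ} {u w : V} (hu : (T ^ n) u = 0) (hw : (T ^ n) w = 0) (z : V) :
    T (cw Q T n u w z) = cw Q T n u w (T z) := by
  cases n with
  | zero => simp [cw, PT]
  | succ n =>
    simp only [cw, PT, map_sum, map_smul, ← pow_succ_app', ← pow_succ_app]
    rw [Finset.sum_range_succ, Finset.sum_range_succ', hw, smul_zero, add_zero]
    have : Bf Q ((T ^ (n + 1 - 1 - 0 + 1)) z) u = 0 := by
      rw [Bf_adj_pow hA]; simp [hu]
    rw [this, zero_smul, add_zero]
    refine Finset.sum_congr rfl fun k hk => ?_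
    simp at hk
    have e : n + 1 - 1 - k = n + 1 - 1 - (k + 1) + 1 := by omega
    rw [e]

lemma Tpow_cw (hA : Alt Q T) {n : ℕ} {u w : V} (hu : (T ^ n) u = 0) (hw : (T ^ n) w = 0)
    (k : ℕ) (z : V) :
    (T ^ k) (cw Q T n u w z) = cw Q T n u w ((T ^ k) z) := by
  induction k with
  | zero => simp
  | succ k ih => rw [pow_succ_app', ih, T_cw hA hu hw, ← pow_succ_app']

lemma cw_zero {n : ℕ} {u w : V} : cw Q T n u w 0 = 0 := by simp [cw, PT]

lemma Bf_cw_v (hA : Alt Q T) {n : ℕ} {u w v : V} (hu : (T ^ n) u = 0)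
    (hvw : ∀ k, Bf Q ((T ^ k) v) w = if k + 1 = n then 1 else 0) (k : ℕ) (z : V) :
    Bf Q ((T ^ k) (cw Q T n u w z)) v = Bf Q ((T ^ k) z) u := by
  rw [cw, Bf_PT]
  simp only [Bf_pow_comm hA _ w v, hvw, mul_ite, mul_one, mul_zero]
  by_cases hk : k < n
  · rw [Finset.sum_eq_single (n - 1 - k)]
    · rw [if_pos (by omega)]; congr 3; congr 2; omega
    · intro j _ hj; rw [if_neg (by omega)]
    · intro h; simp at h; omega
  · rw [Finset.sum_eq_zero, Bf_adj_pow hA, pow_app_eq_zero hu (by omega), map_zero]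
    intro j _; rw [if_neg (by omega)]

lemma Bf_cw_zero {n : ℕ} {u w x : V} (h : ∀ k, Bf Q ((T ^ k) w) x = 0) (k : ℕ) (z : V) :
    Bf Q ((T ^ k) (cw Q T n u w z)) x = 0 := by
  rw [cw, Bf_PT]
  exact Finset.sum_eq_zero fun j _ => by rw [h, mul_zero]

lemma Q_cw (hA : Alt Q T) {n : ℕ} {u w : V} (h : ∀ k, Q ((T ^ k) w) = 0) (k : ℕ) (z : V) :
    Q ((T ^ k) (cw Q T n u w z)) = 0 := by
  rw [cw, Q_PT hA]
  exact Finset.sum_eq_zero fun j _ => by rw [h, mul_zero]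

lemma chi_mem (m : ℕ) : ∀ v : V, (T ^ m) v = 0 → Q ((T ^ (Q.indexChi T m)) v) = 0 := by
  have : Q.indexChi T m ∈ {j : ℕ | ∀ v : V, (T ^ m) v = 0 → Q ((T ^ j) v) = 0} := by
    apply Nat.sInf_mem
    exact ⟨m, fun v hv => by rw [hv]; simp⟩
  exact this

lemma chi_up (m k : ℕ) (hk : Q.indexChi T m ≤ k) (v : V) (hv : (T ^ m) v = 0) :
    Q ((T ^ k) v) = 0 := by
  obtain ⟨d, rfl⟩ := Nat.exists_eq_add_of_le hk
  rw [← pow_add_app]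
  apply chi_mem
  rw [pow_add_app, add_comm, ← pow_add_app, hv, map_zero]

lemma chi_lt (m k : ℕ) (hk : k < Q.indexChi T m) : ∃ v : V, (T ^ m) v = 0 ∧ Q ((T ^ k) v) ≠ 0 := by
  by_contra! h
  have : Q.indexChi T m ≤ k := Nat.sInf_le h
  omega

lemma improve (hA : Alt Q T) {ι : Type} [DecidableEq ι] {v w : ι → V} {p n l : ι → ℕ}
    (F : Fam Q T v w p n l) (i : ι) (hpi : p i = n i) :
    ∃ v' w' : ι → V, Fam Q T v' w' p n (Function.update l i (Q.indexChi T (n i))) := by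
  by_cases hla : l i = Q.indexChi T (n i)
  · exact ⟨v, w, by rw [← hla, Function.update_eq_self]; exact F⟩
  set a := Q.indexChi T (n i) with ha
  have tvi : (T ^ n i) (v i) = 0 := hpi ▸ F.tv i
  have hl1 := F.hl1 i
  have hnl := F.hnl i
  have hlt : l i < a := by
    by_contra hc
    have := chi_up (Q := Q) (T := T) (n i) (l i - 1) (by omega) (v i) tvi
    rw [F.Qv, if_pos (by omega)] at this
    exact one_ne_zero this
  obtain ⟨x, hx, hQx⟩ := chi_lt (Q := Q) (T := T) (n i) (a - 1) (by omega)
  have hwv : ∀ k, Bf Q ((T ^ k) (w i)) (v i) = if k + 1 = n i then 1 else 0 := by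
    intro k; rw [Bf_pow_comm hA, F.vw]
  -- the projection to the plane and its complement
  set d := cw Q T (n i) (w i) (v i) x + cw Q T (n i) (v i) (w i) x with hd
  obtain ⟨u, hu⟩ : ∃ u, u = x + d := ⟨_, rfl⟩
  have tu : (T ^ n i) u = 0 := by
    rw [hu, hd, map_add, map_add, Tpow_cw hA (F.tw i) tvi, Tpow_cw hA tvi (F.tw i), hx]
    simp [cw_zero]
  have uw : ∀ k, Bf Q ((T ^ k) u) (w i) = 0 := by
    intro k
    rw [hu, hd, map_add, map_add, map_add, map_add, LinearMap.add_apply, LinearMap.add_apply,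
      Bf_cw_v hA (F.tw i) hwv, Bf_cw_zero (fun k => Bf_pow_self hA k _), add_zero,
      CharTwo.add_self_eq_zero]
  have uv : ∀ k, Bf Q ((T ^ k) u) (v i) = 0 := by
    intro k
    rw [hu, hd, map_add, map_add, map_add, map_add, LinearMap.add_apply, LinearMap.add_apply,
      Bf_cw_v hA tvi (F.vw i), Bf_cw_zero (fun k => Bf_pow_self hA k _), zero_add,
      CharTwo.add_self_eq_zero]
  have hQu : Q ((T ^ (a - 1)) u) ≠ 0 := by
    have hxd : x = u + d := by
      rw [hu, add_assoc, hd]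
      have : ∀ y : V, y + y = 0 := fun y => by
        rw [← two_smul K y, CharTwo.two_eq_zero, zero_smul]
      rw [this, add_zero]
    have hud : ∀ k, Bf Q ((T ^ k) d) u = 0 := by
      intro k
      rw [hd, map_add, map_add, LinearMap.add_apply,
        Bf_cw_zero (fun k => by rw [Bf_pow_comm hA, uv]),
        Bf_cw_zero (fun k => by rw [Bf_pow_comm hA, uw]), add_zero]
    have hQd : Q ((T ^ (a - 1)) d) = 0 := by
      rw [hd, map_add, Q_add, Q_cw hA (F.Qw i), cw, Q_PT hA, Finset.sum_eq_zero, zero_add,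
        zero_add, Bf_pow_pow hA, cw, Bf_PT, Finset.sum_eq_zero]
      · intro k _
        rw [Bf_PT' hA, Finset.sum_eq_zero, mul_zero]
        intro j _
        rw [F.vw, if_neg (by omega), mul_zero]
      · intro k _
        rw [F.Qv, if_neg (by omega), mul_zero]
    rw [hxd, map_add, Q_add, hQd, Bf_comm, Bf_pow_pow hA, hud] at hQx
    simpa using hQx
  have hQvi : Q ((T ^ (a - 1)) (v i)) = 0 := by rw [F.Qv, if_neg (by omega)]
  obtain ⟨v1, w1, tv1, tw1, Bvw1, Qv1, Qw1, U1⟩ := plane hA (v i + u) (w i) (n i) (n i) a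
    (Or.inl rfl) (by omega) (by omega) (by omega) (by rw [map_add, tvi, tu, add_zero]) (F.tw i)
    (by
      intro hn
      rw [map_add, map_add, LinearMap.add_apply, uw, F.vw, if_pos (by omega)]; simp)
    (by
      intro hn
      have := F.tw i
      rw [hn] at this; simpa using this)
    (by
      rw [map_add, Q_add, hQvi, Bf_comm, Bf_pow_pow hA, uv]
      simpa using hQu)
    (fun k hk => chi_up (n i) k hk _ (by rw [map_add, tvi, tu, add_zero]))
    (fun k hk => F.Qw i k)
  set g : V → V := fun z => z + cw Q T (n i) u (w i) z with hg
  -- facts about g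
  have g_v : ∀ z, (∀ k, Bf Q ((T ^ k) z) (v i) = 0) → (∀ k, Bf Q ((T ^ k) z) (w i) = 0) →
      (∀ k, Bf Q ((T ^ k) (g z)) (v1) = 0) ∧ (∀ k, Bf Q ((T ^ k) (g z)) (w1) = 0) := by
    intro z zv zw
    have h1 := U1 (perpT Q T (g z)) (perpT_stable _)
      (by
        intro k
        rw [Bf_pow_comm hA, hg]
        simp only [map_add, LinearMap.add_apply]
        rw [zv, Bf_cw_v hA tu (F.vw i), zero_add,
          Bf_cw_zero (fun k => by rw [Bf_pow_comm hA, uw]), add_zero,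
          CharTwo.add_self_eq_zero])
      (by
        intro k
        rw [Bf_pow_comm hA, hg]
        simp only [map_add, LinearMap.add_apply]
        rw [zw, Bf_cw_zero (fun k => Bf_pow_self hA _ _), zero_add])
    exact ⟨fun k => by rw [Bf_pow_comm hA]; exact h1.1 k,
      fun k => by rw [Bf_pow_comm hA]; exact h1.2 k⟩
  have g_g : ∀ z y, (∀ k, Bf Q ((T ^ k) z) (w i) = 0) → (∀ k, Bf Q ((T ^ k) y) (w i) = 0) →
      ∀ k, Bf Q ((T ^ k) (g z)) (g y) = Bf Q ((T ^ k) z) y := by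
    intro z y zw yw k
    simp only [hg, map_add, LinearMap.add_apply]
    have h1 : Bf Q ((T ^ k) (cw Q T (n i) u (w i) z)) y = 0 :=
      Bf_cw_zero (fun k => by rw [Bf_pow_comm hA, yw]) k z
    have h2 : Bf Q ((T ^ k) z) (cw Q T (n i) u (w i) y) = 0 := by
      rw [Bf_pow_comm hA]
      exact Bf_cw_zero (fun k => by rw [Bf_pow_comm hA, zw]) k y
    have h3 : Bf Q ((T ^ k) (cw Q T (n i) u (w i) z)) (cw Q T (n i) u (w i) y) = 0 := by
      refine Bf_cw_zero (fun k => ?_) k z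
      rw [Bf_pow_comm hA]
      exact Bf_cw_zero (fun k => Bf_pow_self hA _ _) k y
    rw [h1, h2, h3]; simp
  have g_Q : ∀ z, (∀ k, Bf Q ((T ^ k) z) (w i) = 0) → ∀ k, Q ((T ^ k) (g z)) = Q ((T ^ k) z) := by
    intro z zw k
    simp only [hg, map_add]
    rw [Q_add, Q_cw hA (F.Qw i), Bf_comm, Bf_pow_pow hA,
      Bf_cw_zero (fun k => by rw [Bf_pow_comm hA, zw])]
    simp
  have g_t : ∀ z k, (T ^ k) z = 0 → (T ^ k) (g z) = 0 := by
    intro z k hz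
    simp only [hg, map_add]
    rw [Tpow_cw hA tu (F.tw i), hz, cw_zero, add_zero]
  have wv' : ∀ i j k, i ≠ j → Bf Q ((T ^ k) (w i)) (v j) = 0 := by
    intro i j k hij
    rw [Bf_pow_comm hA, F.vw' _ _ _ hij.symm]
  refine ⟨fun j => if j = i then v1 else g (v j), fun j => if j = i then w1 else g (w j), ?_⟩
  have gv : ∀ j, j ≠ i → (∀ k, Bf Q ((T ^ k) (g (v j))) (v1) = 0) ∧
      (∀ k, Bf Q ((T ^ k) (g (v j))) (w1) = 0) := fun j hj =>
    g_v (v j) (fun k => F.vv j i k hj) (fun k => F.vw' j i k hj)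
  have gw : ∀ j, j ≠ i → (∀ k, Bf Q ((T ^ k) (g (w j))) (v1) = 0) ∧
      (∀ k, Bf Q ((T ^ k) (g (w j))) (w1) = 0) := fun j hj =>
    g_v (w j) (fun k => wv' j i k hj) (fun k => F.ww j i k hj)
  refine ⟨?_, ?_, ?_, ?_, ?_, ?_, ?_, ?_, F.hp, ?_, F.hp1, ?_, ?_, F.hD⟩
  · intro j j' k hjj
    by_cases h1 : j = i
    · have h2 : j' ≠ i := fun h => hjj (h1.trans h.symm)
      simp only [if_pos h1, if_neg h2]
      rw [Bf_pow_comm hA]; exact (gv j' h2).1 k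
    · by_cases h2 : j' = i
      · simp only [if_neg h1, if_pos h2]
        exact (gv j h1).1 k
      · simp only [if_neg h1, if_neg h2]
        rw [g_g _ _ (fun k => F.vw' j i k h1) (fun k => F.vw' j' i k h2)]
        exact F.vv j j' k hjj
  · intro j j' k hjj
    by_cases h1 : j = i
    · have h2 : j' ≠ i := fun h => hjj (h1.trans h.symm)
      simp only [if_pos h1, if_neg h2]
      rw [Bf_pow_comm hA]; exact (gw j' h2).2 k
    · by_cases h2 : j' = i
      · simp only [if_neg h1, if_pos h2]
        exact (gw j h1).2 k
      · simp only [if_neg h1, if_neg h2]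
        rw [g_g _ _ (fun k => F.ww j i k h1) (fun k => F.ww j' i k h2)]
        exact F.ww j j' k hjj
  · intro j j' k hjj
    by_cases h1 : j = i
    · have h2 : j' ≠ i := fun h => hjj (h1.trans h.symm)
      simp only [if_pos h1, if_neg h2]
      rw [Bf_pow_comm hA]; exact (gw j' h2).1 k
    · by_cases h2 : j' = i
      · simp only [if_neg h1, if_pos h2]
        exact (gv j h1).2 k
      · simp only [if_neg h1, if_neg h2]
        rw [g_g _ _ (fun k => F.vw' j i k h1) (fun k => F.ww j' i k h2)]
        exact F.vw' j j' k hjj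
  · intro j k
    by_cases h1 : j = i
    · simp only [if_pos h1]; rw [h1]; exact Bvw1 k
    · simp only [if_neg h1]
      rw [g_g _ _ (fun k => F.vw' j i k h1) (fun k => F.ww j i k h1)]
      exact F.vw j k
  · intro j k
    by_cases h1 : j = i
    · subst h1; simp only [if_true, Function.update_self]; exact Qv1 k
    · simp only [if_neg h1, Function.update_of_ne h1]
      rw [g_Q _ (fun k => F.vw' j i k h1)]
      exact F.Qv j k
  · intro j k
    by_cases h1 : j = i
    · simp only [if_pos h1]; exact Qw1 k
    · simp only [if_neg h1]
      rw [g_Q _ (fun k => F.ww j i k h1)]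
      exact F.Qw j k
  · intro j
    by_cases h1 : j = i
    · simp only [if_pos h1]; rw [h1, hpi]; exact tv1
    · simp only [if_neg h1]
      exact g_t _ _ (F.tv j)
  · intro j
    by_cases h1 : j = i
    · simp only [if_pos h1]; rw [h1]; exact tw1
    · simp only [if_neg h1]
      exact g_t _ _ (F.tw j)
  · intro j hj
    by_cases h1 : j = i
    · subst h1; omega
    · rw [Function.update_of_ne h1]; exact F.hl j hj
  · intro j
    by_cases h1 : j = i
    · subst h1; rw [Function.update_self]; omega
    · rw [Function.update_of_ne h1]; exact F.hl1 j
  · intro j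
    by_cases h1 : j = i
    · subst h1; rw [Function.update_self]; omega
    · rw [Function.update_of_ne h1]; exact F.hnl j

lemma improve_all (hA : Alt Q T) {ι : Type} [Fintype ι] {v w : ι → V} {p n l : ι → ℕ}
    (F : Fam Q T v w p n l) :
    ∃ (v' w' : ι → V) (l' : ι → ℕ), Fam Q T v' w' p n l' ∧
      ∀ i, p i = n i → l' i = Q.indexChi T (n i) := by
  classical
  have key : ∀ s : Finset ι, ∃ (v' w' : ι → V) (l' : ι → ℕ), Fam Q T v' w' p n l' ∧
      ∀ i ∈ s, p i = n i → l' i = Q.indexChi T (n i) := by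
    intro s
    induction s using Finset.induction_on with
    | empty => exact ⟨v, w, l, F, by simp⟩
    | insert i s hi ih =>
      obtain ⟨v', w', l', F', h⟩ := ih
      by_cases hpi : p i = n i
      · obtain ⟨v2, w2, F2⟩ := improve hA F' i hpi
        refine ⟨v2, w2, _, F2, ?_⟩
        intro j hj hpj
        by_cases hji : j = i
        · subst hji; simp
        · rw [Function.update_of_ne hji]
          exact h j (Finset.mem_of_mem_insert_of_ne hj hji) hpj
      · refine ⟨v', w', l', F', ?_⟩
        intro j hj hpj
        have hji : j ≠ i := fun e => hpi (e ▸ hpj)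
        exact h j (Finset.mem_of_mem_insert_of_ne hj hji) hpj
  obtain ⟨v', w', l', F', h⟩ := key Finset.univ
  exact ⟨v', w', l', F', fun i => h i (Finset.mem_univ i)⟩

end fam

end FormMod

namespace FormMod

section exist

variable {K V : Type*} [Field K] [AddCommGroup V] [Module K V] [IsAlgClosed K] [CharP K 2]
  {Q : QuadraticForm K V} {T : Module.End K V}

lemma split_finrank [FiniteDimensional K V] {α : Type} [Fintype α] [DecidableEq α]
    (U : Submodule K V) (L : V →ₗ[K] (α → K)) (e : α → V) (he : ∀ a, e a ∈ U)
    (hL : ∀ a b, L (e a) b = if a = b then 1 else 0) :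
    finrank K U = finrank K (U ⊓ LinearMap.ker L : Submodule K V) + Fintype.card α ∧
      ∀ z ∈ U, ∃ c : α → K, z - ∑ a, c a • e a ∈ U ⊓ LinearMap.ker L := by
  have hsum : ∀ c : α → K, L (∑ a, c a • e a) = c := by
    intro c
    ext b
    simp [map_sum, hL]
  have hmem : ∀ c : α → K, ∑ a, c a • e a ∈ U := fun c =>
    Submodule.sum_mem _ fun a _ => Submodule.smul_mem _ _ (he a)
  constructor
  · have h := LinearMap.finrank_range_add_finrank_ker (L.domRestrict U)
    have hr : LinearMap.range (L.domRestrict U) = ⊤ := by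
      rw [LinearMap.range_eq_top]
      intro c
      exact ⟨⟨_, hmem c⟩, hsum c⟩
    rw [hr, finrank_top, Module.finrank_fintype_fun_eq_card] at h
    have hk : finrank K (LinearMap.ker (L.domRestrict U)) =
        finrank K (U ⊓ LinearMap.ker L : Submodule K V) := by
      have : (LinearMap.ker (L.domRestrict U)).map U.subtype = U ⊓ LinearMap.ker L := by
        ext x
        simp only [Submodule.mem_map, LinearMap.mem_ker, Submodule.mem_inf]
        constructor
        · rintro ⟨y, hy, rfl⟩
          exact ⟨y.2, hy⟩
        · rintro ⟨h1, h2⟩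
          exact ⟨⟨x, h1⟩, h2, rfl⟩
      rw [← this]
      exact (Submodule.finrank_map_subtype_eq U _).symm
    omega
  · intro z hz
    refine ⟨L z, U.sub_mem hz (hmem _), ?_⟩
    show L _ = 0
    rw [map_sub, hsum, sub_self]

lemma Fam.cons {ι : Type} {v w : ι → V} {p n l : ι → ℕ} (hA : Alt Q T)
    (F : Fam Q T v w p n l) (v0 w0 : V) (p0 n0 l0 : ℕ)
    (hv : ∀ i k, Bf Q ((T ^ k) (v i)) v0 = 0 ∧ Bf Q ((T ^ k) (w i)) v0 = 0)
    (hw : ∀ i k, Bf Q ((T ^ k) (v i)) w0 = 0 ∧ Bf Q ((T ^ k) (w i)) w0 = 0)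
    (vw : ∀ k, Bf Q ((T ^ k) v0) w0 = if k + 1 = n0 then 1 else 0)
    (Qv : ∀ k, Q ((T ^ k) v0) = if k + 1 = l0 then 1 else 0)
    (Qw : ∀ k, Q ((T ^ k) w0) = 0)
    (tv : (T ^ p0) v0 = 0) (tw : (T ^ n0) w0 = 0)
    (hp : p0 = n0 ∨ p0 = n0 + 1) (hl : p0 = n0 + 1 → l0 = p0) (hp1 : 1 ≤ p0) (hl1 : 1 ≤ l0)
    (hnl : n0 ≤ 2 * l0) (hD : p0 = n0 + 1 → ∀ i, p i = n i) :
    Fam Q T (fun o : Option ι => o.elim v0 v) (fun o => o.elim w0 w) (fun o => o.elim p0 p)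
      (fun o => o.elim n0 n) (fun o => o.elim l0 l) := by
  refine ⟨?_, ?_, ?_, ?_, ?_, ?_, ?_, ?_, ?_, ?_, ?_, ?_, ?_, ?_⟩
  · rintro (_ | i) (_ | j) k hij
    · exact absurd rfl hij
    · simp only [Option.elim]; rw [Bf_pow_comm hA]; exact (hv j k).1
    · exact (hv i k).1
    · exact F.vv i j k (fun h => hij (by rw [h]))
  · rintro (_ | i) (_ | j) k hij
    · exact absurd rfl hij
    · simp only [Option.elim]; rw [Bf_pow_comm hA]; exact (hw j k).2
    · exact (hw i k).2
    · exact F.ww i j k (fun h => hij (by rw [h]))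
  · rintro (_ | i) (_ | j) k hij
    · exact absurd rfl hij
    · simp only [Option.elim]; rw [Bf_pow_comm hA]; exact (hv j k).2
    · exact (hw i k).1
    · exact F.vw' i j k (fun h => hij (by rw [h]))
  · rintro (_ | i) k
    · exact vw k
    · exact F.vw i k
  · rintro (_ | i) k
    · exact Qv k
    · exact F.Qv i k
  · rintro (_ | i) k
    · exact Qw k
    · exact F.Qw i k
  · rintro (_ | i)
    · exact tv
    · exact F.tv i
  · rintro (_ | i)
    · exact tw
    · exact F.tw i
  · rintro (_ | i)
    · exact hp
    · exact F.hp i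
  · rintro (_ | i)
    · exact hl
    · exact F.hl i
  · rintro (_ | i)
    · exact hp1
    · exact F.hp1 i
  · rintro (_ | i)
    · exact hl1
    · exact F.hl1 i
  · rintro (_ | i)
    · exact hnl
    · exact F.hnl i
  · rintro (_ | i) (_ | j) h1 h2
    · rfl
    · simp only [Option.elim] at h1 h2
      have := hD h1 j; omega
    · simp only [Option.elim] at h1 h2
      have := hD h2 i; omega
    · rw [F.hD i j h1 h2]

lemma pow_mem {U : Submodule K V} (hU : ∀ x ∈ U, T x ∈ U) {x : V} (hx : x ∈ U) (k : ℕ) :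
    (T ^ k) x ∈ U := by
  induction k with
  | zero => simpa
  | succ k ih => rw [pow_succ_app']; exact hU _ ih

/-- Finding a normalised plane of maximal order in a nondegenerate stable subspace. -/
lemma exists_plane (hA : Alt Q T) (hnil : IsNilpotent T) (U : Submodule K V)
    (hU : ∀ x ∈ U, T x ∈ U) (hnd : ∀ x ∈ U, (∀ y ∈ U, Bf Q x y = 0) → x = 0) (hne : U ≠ ⊥) :
    ∃ (v w : V) (n l : ℕ), v ∈ U ∧ w ∈ U ∧ 1 ≤ n ∧ 1 ≤ l ∧ n ≤ 2 * l ∧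
      (T ^ n) v = 0 ∧ (T ^ n) w = 0 ∧
      (∀ k, Bf Q ((T ^ k) v) w = if k + 1 = n then 1 else 0) ∧
      (∀ k, Q ((T ^ k) v) = if k + 1 = l then 1 else 0) ∧ (∀ k, Q ((T ^ k) w) = 0) := by
  classical
  obtain ⟨N, hN⟩ := hnil
  have ex1 : ∃ m, ∀ x ∈ U, (T ^ m) x = 0 := ⟨N, fun x _ => by rw [hN]; rfl⟩
  obtain ⟨n, hn⟩ : ∃ n, n = Nat.find ex1 := ⟨_, rfl⟩
  have hn1 : ∀ x ∈ U, (T ^ n) x = 0 := hn ▸ Nat.find_spec ex1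
  have hnpos : 1 ≤ n := by
    by_contra h
    have h0 : n = 0 := by omega
    apply hne
    rw [Submodule.eq_bot_iff]
    intro x hx
    have := hn1 x hx
    rw [h0] at this
    simpa using this
  obtain ⟨x, hxU, hx⟩ : ∃ x ∈ U, (T ^ (n - 1)) x ≠ 0 := by
    have := Nat.find_min ex1 (m := n - 1) (by omega)
    push Not at this
    exact this
  have ex2 : ∃ m, ∀ x ∈ U, Q ((T ^ m) x) = 0 := ⟨n, fun x hx => by rw [hn1 x hx]; simp⟩
  obtain ⟨l, hl⟩ : ∃ l, l = Nat.find ex2 := ⟨_, rfl⟩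
  have hl0 : ∀ x ∈ U, Q ((T ^ l) x) = 0 := hl ▸ Nat.find_spec ex2
  have hlk : ∀ k, l ≤ k → ∀ x ∈ U, Q ((T ^ k) x) = 0 := by
    intro k hk x hx
    obtain ⟨d, rfl⟩ := Nat.exists_eq_add_of_le hk
    rw [← pow_add_app]; exact hl0 _ (pow_mem hU hx d)
  have hnl : n ≤ 2 * l := by
    by_contra hc
    apply hx
    apply hnd _ (pow_mem hU hxU _)
    intro y hy
    have e : n - 1 = l + (l + (n - 1 - 2 * l)) := by omega
    have h1 := hl0 _ (U.add_mem (pow_mem hU hxU (n - 1 - 2 * l)) hy)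
    rw [map_add, Q_add, hl0 _ (pow_mem hU hxU _), hl0 _ hy, Bf_pow_pow hA, pow_add_app] at h1
    rw [e, ← add_assoc]
    simpa using h1
  have hl1 : 1 ≤ l := by omega
  obtain ⟨y, hyU, hy⟩ : ∃ x ∈ U, Q ((T ^ (l - 1)) x) ≠ 0 := by
    have := Nat.find_min ex2 (m := l - 1) (by omega)
    push Not at this
    exact this
  obtain ⟨v, hvU, hv1, hv2⟩ : ∃ v ∈ U, (T ^ (n - 1)) v ≠ 0 ∧ Q ((T ^ (l - 1)) v) ≠ 0 := by
    by_cases h1 : (T ^ (n - 1)) y = 0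
    · by_cases h2 : Q ((T ^ (l - 1)) x) = 0
      · have hc : ∀ c : K, c ≠ 0 →
            Q ((T ^ (l - 1)) y) + c * Bf Q ((T ^ (l - 1)) y) ((T ^ (l - 1)) x) ≠ 0 →
            ∃ v ∈ U, (T ^ (n - 1)) v ≠ 0 ∧ Q ((T ^ (l - 1)) v) ≠ 0 := by
          intro c hc0 hc1
          refine ⟨y + c • x, U.add_mem hyU (U.smul_mem _ hxU), ?_, ?_⟩
          · rw [map_add, h1, zero_add, map_smul]
            exact smul_ne_zero hc0 hx
          · rw [map_add, Q_add, map_smul, Q_smul, h2, map_smul, smul_eq_mul, mul_zero, add_zero]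
            exact hc1
        set β := Bf Q ((T ^ (l - 1)) y) ((T ^ (l - 1)) x)
        by_cases h3 : Q ((T ^ (l - 1)) y) + 1 * β = 0
        · obtain ⟨c, hcc⟩ := Infinite.exists_notMem_finset ({0, 1} : Finset K)
          simp only [Finset.mem_insert, Finset.mem_singleton, not_or] at hcc
          refine hc c hcc.1 ?_
          rw [one_mul] at h3
          have h4 : Q ((T ^ (l - 1)) y) = β := CharTwo.add_eq_zero.mp h3
          rw [h4] at hy ⊢
          intro h5
          have h6 : (1 + c) * β = 0 := by linear_combination h5
          rcases mul_eq_zero.mp h6 with h7 | h7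
          · exact hcc.2 (CharTwo.add_eq_zero.mp h7).symm
          · exact hy h7
        · exact hc 1 one_ne_zero h3
      · exact ⟨x, hxU, hx, h2⟩
    · exact ⟨y, hyU, h1, hy⟩
  obtain ⟨w, hwU, hw⟩ : ∃ w ∈ U, Bf Q ((T ^ (n - 1)) v) w ≠ 0 := by
    by_contra! h
    exact hv1 (hnd _ (pow_mem hU hvU _) h)
  obtain ⟨v', w', h1, h2, h3, h4, h5, h6⟩ := plane hA v w n n l (Or.inl rfl) (by omega) hl1 hnl
    (hn1 v hvU) (hn1 w hwU) (fun _ => hw) (by omega) hv2 (fun k hk => hlk k hk v hvU)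
    (fun k hk => hlk k hk w hwU)
  obtain ⟨hv', hw'⟩ := h6 U hU hvU hwU
  exact ⟨v', w', n, l, hv', hw', hnpos, hl1, hnl, h1, h2, h3, h4, h5⟩

lemma exists_fam [FiniteDimensional K V] (hA : Alt Q T) (hnil : IsNilpotent T) (d : ℕ) :
    ∀ (U : Submodule K V), (∀ x ∈ U, T x ∈ U) →
    (∀ x ∈ U, (∀ y ∈ U, Bf Q x y = 0) → x = 0) → finrank K U = d →
    ∃ (ι : Type) (_ : Fintype ι) (v w : ι → V) (n l : ι → ℕ), Fam Q T v w n n l ∧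
      (∀ i, v i ∈ U ∧ w i ∈ U) ∧ ∑ i, (n i + n i) = d := by
  induction d using Nat.strong_induction_on with
  | _ d ih =>
  intro U hU hnd hd
  by_cases hne : U = ⊥
  · refine ⟨Empty, inferInstance, nofun, nofun, nofun, nofun,
      ⟨nofun, nofun, nofun, nofun, nofun, nofun, nofun, nofun, nofun, nofun, nofun, nofun, nofun,
        nofun⟩, nofun, ?_⟩
    rw [hne, finrank_bot] at hd
    simp [← hd]
  obtain ⟨v, w, n, l, hv, hw, hn, hl, hnl, tv, tw, vw, Qv, Qw⟩ := exists_plane hA hnil U hU hnd hne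
  have wv : ∀ k, Bf Q ((T ^ k) w) v = if k + 1 = n then 1 else 0 := by
    intro k; rw [Bf_pow_comm hA, vw]
  let L : V →ₗ[K] (Fin n ⊕ Fin n → K) := LinearMap.pi fun a =>
    Sum.elim (fun k : Fin n => ((Bf Q).flip w).comp (T ^ (k : ℕ)))
      (fun k : Fin n => ((Bf Q).flip v).comp (T ^ (k : ℕ))) a
  let e : Fin n ⊕ Fin n → V := Sum.elim (fun k => (T ^ (n - 1 - (k : ℕ))) v)
    (fun k => (T ^ (n - 1 - (k : ℕ))) w)
  have he : ∀ a, e a ∈ U := by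
    rintro (k | k)
    · exact pow_mem hU hv _
    · exact pow_mem hU hw _
  have hL : ∀ a b, L (e a) b = if a = b then 1 else 0 := by
    rintro (k | k) (j | j)
    · simp only [L, e, LinearMap.pi_apply, Sum.elim_inl, LinearMap.comp_apply,
        LinearMap.flip_apply, pow_add_app, vw, Sum.inl.injEq, Fin.ext_iff]
      exact if_congr (by omega) rfl rfl
    · simp [L, e, pow_add_app, Bf_pow_self hA]
    · simp [L, e, pow_add_app, Bf_pow_self hA]
    · simp only [L, e, LinearMap.pi_apply, Sum.elim_inr, LinearMap.comp_apply,
        LinearMap.flip_apply, pow_add_app, wv, Sum.inr.injEq, Fin.ext_iff]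
      exact if_congr (by omega) rfl rfl
  obtain ⟨hfr, hsp⟩ := split_finrank U L e he hL
  have memL : ∀ x, x ∈ LinearMap.ker L ↔
      ∀ k, Bf Q ((T ^ k) x) v = 0 ∧ Bf Q ((T ^ k) x) w = 0 := by
    intro x
    rw [LinearMap.mem_ker]
    constructor
    · intro h k
      by_cases hk : k < n
      · have h1 := congrFun h (Sum.inl ⟨k, hk⟩)
        have h2 := congrFun h (Sum.inr ⟨k, hk⟩)
        exact ⟨h2, h1⟩
      · rw [Bf_adj_pow hA, Bf_adj_pow hA, pow_app_eq_zero tv (by omega),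
          pow_app_eq_zero tw (by omega)]
        simp
    · intro h
      ext (k | k)
      · exact (h k).2
      · exact (h k).1
  set U' := U ⊓ LinearMap.ker L with hU'
  have hU's : ∀ x ∈ U', T x ∈ U' := by
    intro x hx
    refine ⟨hU x hx.1, (memL _).2 ?_⟩
    intro k
    rw [← pow_succ_app]
    exact (memL x).1 hx.2 _
  have hnd' : ∀ x ∈ U', (∀ y ∈ U', Bf Q x y = 0) → x = 0 := by
    intro x hx h
    apply hnd x hx.1
    intro y hy
    obtain ⟨c, hc⟩ := hsp y hy
    have h1 := h _ hc
    rw [map_sub, map_sum, Finset.sum_eq_zero, sub_zero] at h1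
    · exact h1
    · intro a _
      rw [map_smul]
      have := (memL x).1 hx.2
      rcases a with k | k
      · simp only [e, Sum.elim_inl]
        rw [← Bf_adj_pow hA, (this _).1, smul_zero]
      · simp only [e, Sum.elim_inr]
        rw [← Bf_adj_pow hA, (this _).2, smul_zero]
  simp only [Fintype.card_sum, Fintype.card_fin] at hfr
  obtain ⟨ι, hι, v1, w1, n1, l1, F1, hm, hs⟩ := ih (finrank K U') (by omega) U' hU's hnd' rfl
  refine ⟨Option ι, inferInstance, _, _, _, _, F1.cons hA v w n n l ?_ ?_ vw Qv Qw tv tw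
    (Or.inl rfl) (by omega) hn hl hnl (by omega), ?_, ?_⟩
  · intro i k
    exact ⟨((memL _).1 (hm i).1.2 k).1, ((memL _).1 (hm i).2.2 k).1⟩
  · intro i k
    exact ⟨((memL _).1 (hm i).1.2 k).2, ((memL _).1 (hm i).2.2 k).2⟩
  · rintro (_ | i)
    · exact ⟨hv, hw⟩
    · exact ⟨(hm i).1.1, (hm i).2.1⟩
  · rw [Fintype.sum_option]
    simp only [Option.elim]
    omega

/-- Splitting off the block containing the radical. -/
lemma exists_D [FiniteDimensional K V] (hA : Alt Q T) (hnil : IsNilpotent T) (r : V)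
    (hr : r ≠ 0) (hQr : Q r ≠ 0)
    (hrad : ∀ x, (∀ y, Bf Q x y = 0) ↔ ∃ c : K, x = c • r) :
    ∃ (v w : V) (n : ℕ) (U : Submodule K V), (T ^ (n + 1)) v = 0 ∧ (T ^ n) w = 0 ∧
      (∀ k, Bf Q ((T ^ k) v) w = if k + 1 = n then 1 else 0) ∧
      (∀ k, Q ((T ^ k) v) = if k + 1 = n + 1 then 1 else 0) ∧ (∀ k, Q ((T ^ k) w) = 0) ∧
      (∀ x ∈ U, T x ∈ U) ∧ (∀ x ∈ U, (∀ y ∈ U, Bf Q x y = 0) → x = 0) ∧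
      (∀ x ∈ U, ∀ k, Bf Q ((T ^ k) x) v = 0 ∧ Bf Q ((T ^ k) x) w = 0) ∧
      finrank K V = finrank K U + (2 * n + 1) := by
  classical
  obtain ⟨N, hN⟩ := hnil
  have hr0 : ∀ y, Bf Q r y = 0 := (hrad r).2 ⟨1, by simp⟩
  have hr0' : ∀ y, Bf Q y r = 0 := fun y => by rw [Bf_comm, hr0]
  have hTr : T r = 0 := by
    obtain ⟨c, hc⟩ := (hrad (T r)).1 (fun y => by rw [Bf_adj hA, hr0])
    have h1 : ∀ k, (T ^ k) r = c ^ k • r := by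
      intro k
      induction k with
      | zero => simp
      | succ k ih => rw [pow_succ_app', ih, map_smul, hc, smul_smul, pow_succ]
    have h2 := h1 N
    rw [hN] at h2
    have h3 : c ^ N = 0 := by
      rcases smul_eq_zero.mp h2.symm with h | h
      · exact h
      · exact absurd h hr
    have h4 : c = 0 := by by_contra h; exact pow_ne_zero N h h3
    rw [hc, h4, zero_smul]
  have ex1 : ∃ m, r ∉ LinearMap.range (T ^ (m + 1)) := by
    refine ⟨N, ?_⟩
    rw [pow_succ, hN]
    simpa using hr
  obtain ⟨n, hn⟩ : ∃ n, n = Nat.find ex1 := ⟨_, rfl⟩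
  have hn1 : r ∉ LinearMap.range (T ^ (n + 1)) := hn ▸ Nat.find_spec ex1
  obtain ⟨v0, hv0⟩ : ∃ v, (T ^ n) v = r := by
    rcases Nat.eq_zero_or_pos n with h | h
    · exact ⟨r, by rw [h]; simp⟩
    · have := Nat.find_min ex1 (m := n - 1) (by omega)
      push Not at this
      rw [Nat.sub_add_cancel h] at this
      exact this
  obtain ⟨f, hfr, hfT⟩ : ∃ f : V →ₗ[K] K, f r = 1 ∧ ∀ z, f ((T ^ (n + 1)) z) = 0 := by
    obtain ⟨f0, hf0, hf1⟩ := Submodule.exists_le_ker_of_notMem hn1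
    refine ⟨(f0 r)⁻¹ • f0, ?_, ?_⟩
    · simp [hf0]
    · intro z
      have : f0 ((T ^ (n + 1)) z) = 0 := hf1 ⟨z, rfl⟩
      simp [this]
  have hTnr : ∀ k, 1 ≤ k → (T ^ k) r = 0 := by
    intro k hk
    apply pow_app_eq_zero (k := 1) (by simpa using hTr) hk
  -- normalise v for f
  obtain ⟨v, hv, hfv⟩ : ∃ v, (T ^ n) v = r ∧ ∀ k, f ((T ^ k) v) = if k = n then 1 else 0 := by
    obtain ⟨c, hc0, hc⟩ := exists_inv (fun k => f ((T ^ k) v0)) n (by simp [hv0, hfr])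
      (fun k hk => by
        obtain ⟨d, rfl⟩ := Nat.exists_eq_add_of_le hk
        show f _ = 0
        rw [Nat.succ_eq_add_one, ← pow_add_app, hfT])
    refine ⟨PT T (n + 1) c v0, ?_, ?_⟩
    · rw [T_PT', hv0, PT, Finset.sum_eq_single 0]
      · simp [hc0, hv0, hfr]
      · intro k _ hk
        rw [hTnr k (by omega), smul_zero]
      · simp
    · intro k
      rw [T_PT, map_sum, ← hc (n + 1) (by omega) k]
      simp
  -- the dual vector
  obtain ⟨y0, hy0⟩ : ∃ y, ∀ z, Bf Q y z = f (T z) := by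
    have hk : LinearMap.ker (Bf Q) = Submodule.span K {r} := by
      ext x
      rw [LinearMap.mem_ker, Submodule.mem_span_singleton]
      constructor
      · intro h
        obtain ⟨c, hc⟩ := (hrad x).1 (fun y => by rw [h]; rfl)
        exact ⟨c, hc.symm⟩
      · rintro ⟨c, rfl⟩
        ext y; simp [hr0]
    have hle : LinearMap.range (Bf Q) ≤ (Submodule.span K {r}).dualAnnihilator := by
      rintro _ ⟨x, rfl⟩
      rw [Submodule.mem_dualAnnihilator]
      intro z hz
      obtain ⟨c, rfl⟩ := Submodule.mem_span_singleton.mp hz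
      simp [hr0']
    have heq : LinearMap.range (Bf Q) = (Submodule.span K {r}).dualAnnihilator := by
      apply Submodule.eq_of_le_of_finrank_eq hle
      have h1 := LinearMap.finrank_range_add_finrank_ker (Bf Q)
      have h2 := Subspace.finrank_add_finrank_dualAnnihilator_eq (Submodule.span K {r})
      rw [hk] at h1
      rw [add_comm] at h2
      exact Nat.add_right_cancel (h1.trans h2.symm)
    have : f.comp T ∈ LinearMap.range (Bf Q) := by
      rw [heq, Submodule.mem_dualAnnihilator]
      intro z hz
      obtain ⟨c, rfl⟩ := Submodule.mem_span_singleton.mp hz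
      simp [hTr]
    obtain ⟨y, hy⟩ := this
    exact ⟨y, fun z => by rw [hy]; rfl⟩
  obtain ⟨y, hy, hfy⟩ : ∃ y, (∀ z, Bf Q y z = f (T z)) ∧ f y = 0 := by
    refine ⟨y0 - f y0 • r, ?_, ?_⟩
    · intro z
      simp [hy0, hr0]
    · simp [hfr]
  have hfTy : ∀ k, f ((T ^ k) y) = 0 := by
    intro k
    cases k with
    | zero => simpa using hfy
    | succ k => rw [pow_succ_app', ← hy, Bf_comm, Bf_pow_self hA]
  have ty : (T ^ n) y = 0 := by
    obtain ⟨c, hc⟩ := (hrad ((T ^ n) y)).1 (fun z => by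
      rw [Bf_adj_pow hA, hy, ← pow_succ_app', hfT])
    have := hfTy n
    rw [hc, map_smul, hfr, smul_eq_mul, mul_one] at this
    rw [hc, this, zero_smul]
  have tv : (T ^ (n + 1)) v = 0 := by rw [pow_succ_app', hv, hTr]
  have vy : ∀ k, Bf Q ((T ^ k) v) y = if k + 1 = n then 1 else 0 := by
    intro k
    rw [Bf_comm, hy, ← pow_succ_app', hfv]
  have yv : ∀ k, Bf Q ((T ^ k) y) v = if k + 1 = n then 1 else 0 := by
    intro k
    rw [Bf_pow_comm hA, vy]
  -- the splitting
  let L : V →ₗ[K] (Fin (n + 1) ⊕ Fin n → K) := LinearMap.pi fun a =>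
    Sum.elim (fun k : Fin (n + 1) => f.comp (T ^ (k : ℕ)))
      (fun k : Fin n => ((Bf Q).flip v).comp (T ^ (k : ℕ))) a
  let e : Fin (n + 1) ⊕ Fin n → V := Sum.elim (fun k => (T ^ (n - (k : ℕ))) v)
    (fun k => (T ^ (n - 1 - (k : ℕ))) y)
  have hL : ∀ a b, L (e a) b = if a = b then 1 else 0 := by
    rintro (k | k) (j | j)
    · simp only [L, e, LinearMap.pi_apply, Sum.elim_inl, LinearMap.comp_apply,
        pow_add_app, hfv, Sum.inl.injEq, Fin.ext_iff]
      exact if_congr (by omega) rfl rfl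
    · simp [L, e, pow_add_app, Bf_pow_self hA]
    · simp [L, e, pow_add_app, hfTy]
    · simp only [L, e, LinearMap.pi_apply, Sum.elim_inr, LinearMap.comp_apply,
        LinearMap.flip_apply, pow_add_app, yv, Sum.inr.injEq, Fin.ext_iff]
      exact if_congr (by omega) rfl rfl
  obtain ⟨hfrk, hsp⟩ := split_finrank ⊤ L e (fun _ => Submodule.mem_top) hL
  have memL : ∀ x, x ∈ LinearMap.ker L ↔
      ∀ k, f ((T ^ k) x) = 0 ∧ Bf Q ((T ^ k) x) v = 0 := by
    intro x
    rw [LinearMap.mem_ker]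
    constructor
    · intro h k
      constructor
      · by_cases hk : k < n + 1
        · exact congrFun h (Sum.inl ⟨k, hk⟩)
        · obtain ⟨d, rfl⟩ := Nat.exists_eq_add_of_le (not_lt.mp hk)
          rw [← pow_add_app, hfT]
      · by_cases hk : k < n
        · exact congrFun h (Sum.inr ⟨k, hk⟩)
        · obtain ⟨d, rfl⟩ := Nat.exists_eq_add_of_le (not_lt.mp hk)
          rw [← pow_add_app, Bf_adj_pow hA, hv, hr0']
    · intro h
      ext (k | k)
      · exact (h k).1
      · exact (h k).2
  rw [top_inf_eq] at hfrk hsp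
  set U := LinearMap.ker L with hU
  have hUs : ∀ x ∈ U, T x ∈ U := by
    intro x hx
    rw [memL]
    intro k
    rw [← pow_succ_app]
    exact (memL x).1 hx _
  have hUy : ∀ x ∈ U, ∀ k, Bf Q ((T ^ k) x) y = 0 := by
    intro x hx k
    rw [Bf_comm, hy, ← pow_succ_app']
    exact ((memL x).1 hx _).1
  have hnd' : ∀ x ∈ U, (∀ y ∈ U, Bf Q x y = 0) → x = 0 := by
    intro x hx h
    obtain ⟨c, hc⟩ := (hrad x).1 (by
      intro z
      obtain ⟨c, hc⟩ := hsp z Submodule.mem_top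
      have h1 := h _ hc
      rw [map_sub, map_sum, Finset.sum_eq_zero, sub_zero] at h1
      · exact h1
      · intro a _
        rw [map_smul]
        rcases a with k | k
        · simp only [e, Sum.elim_inl]
          rw [← Bf_adj_pow hA, ((memL x).1 hx _).2, smul_zero]
        · simp only [e, Sum.elim_inr]
          rw [← Bf_adj_pow hA, hUy x hx, smul_zero])
    have h2 := ((memL x).1 hx 0).1
    rw [pow_zero_app, hc, map_smul, hfr, smul_eq_mul, mul_one] at h2
    rw [hc, h2, zero_smul]
  obtain ⟨v', w', h1, h2, h3, h4, h5, h6⟩ := plane hA v y (n + 1) n (n + 1) (Or.inr rfl)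
    (fun _ => rfl) (by omega) (by omega) tv ty
    (fun h => by rw [vy, if_pos (by omega)]; exact one_ne_zero)
    (fun h => by rw [h] at ty; simpa using ty)
    (by rw [Nat.add_sub_cancel, hv]; exact hQr)
    (fun k hk => by rw [pow_app_eq_zero tv hk]; simp)
    (fun k hk => by rw [pow_app_eq_zero ty (by omega)]; simp)
  refine ⟨v', w', n, U, h1, h2, h3, h4, h5, hUs, hnd', ?_, ?_⟩
  · intro x hx k
    obtain ⟨ha, hb⟩ := h6 (perpT Q T x) (perpT_stable x)
      (fun k => by rw [Bf_pow_comm hA]; exact ((memL x).1 hx k).2)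
      (fun k => by rw [Bf_pow_comm hA]; exact hUy x hx k)
    exact ⟨by rw [Bf_pow_comm hA]; exact ha k, by rw [Bf_pow_comm hA]; exact hb k⟩
  · simp only [Fintype.card_sum, Fintype.card_fin, finrank_top] at hfrk
    omega

lemma normal_form [FiniteDimensional K V] (hA : Alt Q T) (hnil : IsNilpotent T)
    (hQ : Q.IsNondegenerateFormSpace) :
    ∃ (ι : Type) (_ : Fintype ι) (v w : ι → V) (p n l : ι → ℕ), Fam Q T v w p n l ∧
      ∑ i, (p i + n i) = finrank K V ∧ ∀ i, p i = n i → l i = Q.indexChi T (n i) := by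
  suffices h : ∃ (ι : Type) (_ : Fintype ι) (v w : ι → V) (p n l : ι → ℕ), Fam Q T v w p n l ∧
      ∑ i, (p i + n i) = finrank K V by
    obtain ⟨ι, hι, v, w, p, n, l, F, hs⟩ := h
    obtain ⟨v', w', l', F', h'⟩ := improve_all hA F
    exact ⟨ι, hι, v', w', p, n, l', F', hs, h'⟩
  obtain ⟨-, h1, h2⟩ := hQ
  have hmem : ∀ x, x ∈ Q.polarRadical ↔ ∀ y, Bf Q x y = 0 := by
    intro x
    rw [QuadraticForm.polarRadical, LinearMap.mem_ker]
    constructor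
    · intro h y
      exact congrArg (fun g => g y) h
    · intro h
      ext y; exact h y
  by_cases hbot : Q.polarRadical = ⊥
  · obtain ⟨ι, hι, v, w, n, l, F, -, hs⟩ := exists_fam hA hnil (finrank K V) ⊤
      (fun _ _ => Submodule.mem_top)
      (fun x _ h => by
        have : x ∈ Q.polarRadical := (hmem x).2 fun y => h y Submodule.mem_top
        rw [hbot] at this
        simpa using this) (finrank_top K V)
    exact ⟨ι, hι, v, w, n, n, l, F, hs⟩
  · obtain ⟨r, hr, hr0⟩ := Submodule.exists_mem_ne_zero_of_ne_bot hbot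
    have hrad : ∀ x, (∀ y, Bf Q x y = 0) ↔ ∃ c : K, x = c • r := by
      intro x
      rw [← hmem]
      constructor
      · intro hx
        have hr' : (⟨r, hr⟩ : Q.polarRadical) ≠ 0 := fun h => hr0 (congrArg Subtype.val h)
        obtain ⟨c, hc⟩ := (finrank_le_one_iff.mp h1)
        obtain ⟨a, ha⟩ := hc ⟨r, hr⟩
        obtain ⟨b, hb⟩ := hc ⟨x, hx⟩
        have ha0 : a ≠ 0 := by
          rintro rfl
          rw [zero_smul] at ha
          exact hr' ha.symm
        refine ⟨b * a⁻¹, ?_⟩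
        have e1 : a • (c : V) = r := congrArg Subtype.val ha
        have e2 : b • (c : V) = x := congrArg Subtype.val hb
        rw [← e1, ← e2, smul_smul, mul_assoc, inv_mul_cancel₀ ha0, mul_one]
      · rintro ⟨c, rfl⟩
        exact Submodule.smul_mem _ _ hr
    obtain ⟨v0, w0, n0, U, tv, tw, vw, Qv, Qw, hU, hnd, horth, hfr⟩ :=
      exists_D hA hnil r hr0 (h2 r hr hr0) hrad
    obtain ⟨ι, hι, v, w, n, l, F, hm, hs⟩ := exists_fam hA hnil (finrank K U) U hU hnd rfl
    refine ⟨Option ι, inferInstance, _, _, _, _, _, F.cons hA v0 w0 (n0 + 1) n0 (n0 + 1) ?_ ?_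
      vw Qv Qw tv tw (Or.inr rfl) (fun _ => rfl) (by omega) (by omega) (by omega)
      (fun _ _ => rfl), ?_⟩
    · intro i k
      exact ⟨(horth _ (hm i).1 k).1, (horth _ (hm i).2 k).1⟩
    · intro i k
      exact ⟨(horth _ (hm i).1 k).2, (horth _ (hm i).2 k).2⟩
    · rw [Fintype.sum_option]
      simp only [Option.elim]
      omega

end exist

end FormMod

namespace FormMod

section iso

variable {K V : Type*} [Field K] [AddCommGroup V] [Module K V] [IsAlgClosed K] [CharP K 2]
  {Q : QuadraticForm K V} {T : Module.End K V}

/-- The family of vectors attached to a normal form. -/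
def fb {ι : Type} (T : Module.End K V) (v w : ι → V) (p n : ι → ℕ) :
    (Σ i, Fin (p i) ⊕ Fin (n i)) → V
  | ⟨i, .inl k⟩ => (T ^ (k : ℕ)) (v i)
  | ⟨i, .inr k⟩ => (T ^ (k : ℕ)) (w i)

open Classical in
/-- The Gram matrix of a normal form. -/
noncomputable def gram {ι : Type} (K : Type*) [Field K] (p n : ι → ℕ) :
    (Σ i, Fin (p i) ⊕ Fin (n i)) → (Σ i, Fin (p i) ⊕ Fin (n i)) → K
  | ⟨_, .inl _⟩, ⟨_, .inl _⟩ => 0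
  | ⟨i, .inl k⟩, ⟨j, .inr m⟩ => if i = j ∧ (k : ℕ) + m + 1 = n i then 1 else 0
  | ⟨i, .inr k⟩, ⟨j, .inl m⟩ => if i = j ∧ (k : ℕ) + m + 1 = n i then 1 else 0
  | ⟨_, .inr _⟩, ⟨_, .inr _⟩ => 0

lemma Fam.gram_eq {ι : Type} {v w : ι → V} {p n l : ι → ℕ} (hA : Alt Q T)
    (F : Fam Q T v w p n l) (x y : Σ i, Fin (p i) ⊕ Fin (n i)) :
    Bf Q (fb T v w p n x) (fb T v w p n y) = gram K p n x y := by
  rcases x with ⟨i, k | k⟩ <;> rcases y with ⟨j, m | m⟩ <;> simp only [fb, gram] <;>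
    rw [Bf_pow_pow hA]
  · by_cases h : i = j
    · subst h; exact Bf_pow_self hA _ _
    · exact F.vv _ _ _ h
  · by_cases h : i = j
    · subst h; simp [F.vw]
    · rw [F.vw' _ _ _ h]; simp [h]
  · rw [Bf_pow_comm hA]
    by_cases h : i = j
    · subst h; simp [F.vw]
    · rw [F.vw' _ _ _ (Ne.symm h)]; simp [h]
  · by_cases h : i = j
    · subst h; exact Bf_pow_self hA _ _
    · exact F.ww _ _ _ h

lemma Fam.linInd {ι : Type} [Fintype ι] {v w : ι → V} {p n l : ι → ℕ} (hA : Alt Q T)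
    (F : Fam Q T v w p n l) : LinearIndependent K (fb T v w p n) := by
  rw [Fintype.linearIndependent_iff]
  intro g hg
  have hB : ∀ y, ∑ x, g x * gram K p n x y = 0 := by
    intro y
    have := congrArg (fun z => Bf Q z (fb T v w p n y)) hg
    simpa [F.gram_eq hA] using this
  have hr : ∀ i (k : Fin (n i)), g ⟨i, .inr k⟩ = 0 := by
    intro i k
    have hk := k.2
    have hp := F.hp i
    have := hB ⟨i, .inl ⟨n i - 1 - k, by omega⟩⟩
    rw [Finset.sum_eq_single ⟨i, .inr k⟩] at this
    · rw [← this]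
      simp only [gram]
      rw [if_pos ⟨trivial, by omega⟩, mul_one]
    · rintro ⟨j, m | m⟩ - hne
      · simp [gram]
      · simp only [gram]
        rw [if_neg, mul_zero]
        rintro ⟨rfl, h⟩
        apply hne
        congr 2
        apply Fin.ext
        omega
    · simp
  have hl : ∀ i (k : Fin (p i)), (k : ℕ) < n i → g ⟨i, .inl k⟩ = 0 := by
    intro i k hk
    have := hB ⟨i, .inr ⟨n i - 1 - k, by omega⟩⟩
    rw [Finset.sum_eq_single ⟨i, .inl k⟩] at this
    · rw [← this]
      simp only [gram]
      rw [if_pos ⟨trivial, by omega⟩, mul_one]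
    · rintro ⟨j, m | m⟩ - hne
      · simp only [gram]
        rw [if_neg, mul_zero]
        rintro ⟨rfl, h⟩
        apply hne
        congr 2
        apply Fin.ext
        omega
      · simp [gram]
    · simp
  rintro ⟨i, k | k⟩
  · by_cases hk : (k : ℕ) < n i
    · exact hl i k hk
    · have hk2 := k.2
      have hpi : p i = n i + 1 := by have := F.hp i; omega
      rw [Finset.sum_eq_single ⟨i, .inl k⟩] at hg
      · have h1 := congrArg Q hg
        simp only [fb] at h1
        rw [Q_smul, F.Qv, F.hl i hpi, if_pos (by omega)] at h1
        simpa using h1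
      · rintro ⟨j, m | m⟩ - hne
        · by_cases hm : (m : ℕ) < n j
          · rw [hl j m hm, zero_smul]
          · have hm2 := m.2
            have hpj : p j = n j + 1 := by have := F.hp j; omega
            have := F.hD i j hpi hpj
            subst this
            exfalso
            apply hne
            congr 2
            apply Fin.ext
            omega
        · rw [hr, zero_smul]
      · simp
  · exact hr i k

lemma Fam.card {ι : Type} [Fintype ι] (p n : ι → ℕ) :
    Fintype.card (Σ i, Fin (p i) ⊕ Fin (n i)) = ∑ i, (p i + n i) := by
  simp

lemma Fam.span_top {ι : Type} [Fintype ι] {v w : ι → V} {p n l : ι → ℕ} [FiniteDimensional K V]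
    (hA : Alt Q T) (F : Fam Q T v w p n l) (hs : ∑ i, (p i + n i) = finrank K V) :
    Submodule.span K (Set.range (fb T v w p n)) = ⊤ :=
  (F.linInd hA).span_eq_top_of_card_eq_finrank' (by rw [Fam.card, hs])

lemma Fam.reindex {ι ι' : Type} {v w : ι' → V} {p n l : ι' → ℕ}
    (F : Fam Q T v w p n l) (e : ι ≃ ι') :
    Fam Q T (v ∘ e) (w ∘ e) (p ∘ e) (n ∘ e) (l ∘ e) where
  vv i j k h := F.vv _ _ k (e.injective.ne h)
  ww i j k h := F.ww _ _ k (e.injective.ne h)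
  vw' i j k h := F.vw' _ _ k (e.injective.ne h)
  vw i k := F.vw _ _
  Qv i k := F.Qv _ _
  Qw i k := F.Qw _ _
  tv i := F.tv _
  tw i := F.tw _
  hp i := F.hp _
  hl i := F.hl _
  hp1 i := F.hp1 _
  hl1 i := F.hl1 _
  hnl i := F.hnl _
  hD i j h h' := e.injective (F.hD _ _ h h')

lemma Fam.iso {V' : Type*} [AddCommGroup V'] [Module K V'] [FiniteDimensional K V]
    [FiniteDimensional K V'] {Q' : QuadraticForm K V'} {T' : Module.End K V'}
    {ι : Type} [Fintype ι] {v w : ι → V} {v' w' : ι → V'} {p n l : ι → ℕ}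
    (hA : Alt Q T) (F : Fam Q T v w p n l) (hs : ∑ i, (p i + n i) = finrank K V)
    (hA' : Alt Q' T') (F' : Fam Q' T' v' w' p n l) (hs' : ∑ i, (p i + n i) = finrank K V') :
    ∃ g : V ≃ₗ[K] V', (∀ v : V, Q' (g v) = Q v) ∧ ∀ v : V, g (T v) = T' (g v) := by
  let b := Basis.mk (F.linInd hA) (F.span_top hA hs).ge
  let b' := Basis.mk (F'.linInd hA') (F'.span_top hA' hs').ge
  let g : V ≃ₗ[K] V' := b.equiv b' (Equiv.refl _)
  have hb : ∀ x, b x = fb T v w p n x := fun x => Basis.mk_apply _ _ x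
  have hb' : ∀ x, b' x = fb T' v' w' p n x := fun x => Basis.mk_apply _ _ x
  have hg : ∀ x, g (fb T v w p n x) = fb T' v' w' p n x := by
    intro x
    rw [← hb, ← hb']
    simp [g]
  have hgv : ∀ i k, g ((T ^ k) (v i)) = (T' ^ k) (v' i) := by
    intro i k
    by_cases hk : k < p i
    · exact hg ⟨i, .inl ⟨k, hk⟩⟩
    · rw [pow_app_eq_zero (F.tv i) (by omega), pow_app_eq_zero (F'.tv i) (by omega), map_zero]
  have hgw : ∀ i k, g ((T ^ k) (w i)) = (T' ^ k) (w' i) := by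
    intro i k
    by_cases hk : k < n i
    · exact hg ⟨i, .inr ⟨k, hk⟩⟩
    · rw [pow_app_eq_zero (F.tw i) (by omega), pow_app_eq_zero (F'.tw i) (by omega), map_zero]
  have hcomm : g.toLinearMap ∘ₗ T = T' ∘ₗ g.toLinearMap := by
    apply b.ext
    rintro ⟨i, k | k⟩
    · rw [hb]
      simp only [fb, LinearMap.comp_apply, LinearEquiv.coe_coe]
      rw [hgv, ← pow_succ_app', ← pow_succ_app', hgv]
    · rw [hb]
      simp only [fb, LinearMap.comp_apply, LinearEquiv.coe_coe]
      rw [hgw, ← pow_succ_app', ← pow_succ_app', hgw]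
  have hpol : (Bf Q').compl₁₂ g.toLinearMap g.toLinearMap = Bf Q := by
    apply b.ext
    intro x
    apply b.ext
    intro y
    simp only [hb, LinearMap.compl₁₂_apply, LinearEquiv.coe_coe]
    rw [hg, hg, F.gram_eq hA, F'.gram_eq hA']
  have hpol' : ∀ x y, Bf Q' (g x) (g y) = Bf Q x y := by
    intro x y
    rw [← hpol]; rfl
  refine ⟨g, ?_, fun x => congrArg (fun f => f x) hcomm⟩
  intro x
  have hx : x ∈ Submodule.span K (Set.range (fb T v w p n)) := by
    rw [F.span_top hA hs]; trivial
  induction hx using Submodule.span_induction with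
  | mem x h =>
    obtain ⟨y, rfl⟩ := h
    rw [hg]
    rcases y with ⟨i, k | k⟩
    · simp only [fb]; rw [F.Qv, F'.Qv]
    · simp only [fb]; rw [F.Qw, F'.Qw]
  | zero => simp
  | add x y _ _ h1 h2 => rw [map_add, Q_add, Q_add, h1, h2, hpol']
  | smul a x _ h => rw [map_smul, Q_smul, Q_smul, h]

lemma Fam.rank {ι : Type} [Fintype ι] {v w : ι → V} {p n l : ι → ℕ} [FiniteDimensional K V]
    (hA : Alt Q T) (F : Fam Q T v w p n l) (hs : ∑ i, (p i + n i) = finrank K V) (j : ℕ) :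
    finrank K (LinearMap.range (T ^ j)) = ∑ i, ((p i - j) + (n i - j)) := by
  let f : (Σ i, Fin (p i - j) ⊕ Fin (n i - j)) → (Σ i, Fin (p i) ⊕ Fin (n i)) := fun x =>
    match x with
    | ⟨i, .inl k⟩ => ⟨i, .inl ⟨k + j, by omega⟩⟩
    | ⟨i, .inr k⟩ => ⟨i, .inr ⟨k + j, by omega⟩⟩
  have hf : Function.Injective f := by
    rintro ⟨i, k | k⟩ ⟨i', k' | k'⟩ h <;> simp only [f] at h
    · obtain ⟨rfl, h⟩ := Sigma.mk.inj h
      have := Sum.inl.inj (eq_of_heq h)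
      rw [Fin.mk.injEq] at this
      congr 2
      apply Fin.ext; omega
    · obtain ⟨rfl, h⟩ := Sigma.mk.inj h
      cases eq_of_heq h
    · obtain ⟨rfl, h⟩ := Sigma.mk.inj h
      cases eq_of_heq h
    · obtain ⟨rfl, h⟩ := Sigma.mk.inj h
      have := Sum.inr.inj (eq_of_heq h)
      rw [Fin.mk.injEq] at this
      congr 2
      apply Fin.ext; omega
  have hli := (F.linInd hA).comp f hf
  have hspan : Submodule.span K (Set.range (fb T v w p n ∘ f)) = LinearMap.range (T ^ j) := by
    apply le_antisymm
    · rw [Submodule.span_le]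
      rintro _ ⟨⟨i, k | k⟩, rfl⟩
      · refine ⟨(T ^ (k : ℕ)) (v i), ?_⟩
        rw [pow_add_app, add_comm]; rfl
      · refine ⟨(T ^ (k : ℕ)) (w i), ?_⟩
        rw [pow_add_app, add_comm]; rfl
    · rw [LinearMap.range_eq_map, ← F.span_top hA hs, Submodule.map_span, Submodule.span_le]
      rintro _ ⟨_, ⟨⟨i, k | k⟩, rfl⟩, rfl⟩
      · simp only [fb]
        rw [pow_add_app]
        by_cases h : (k : ℕ) + j < p i
        · apply Submodule.subset_span
          exact ⟨⟨i, .inl ⟨k, by omega⟩⟩, by simp [f, fb, add_comm]⟩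
        · rw [pow_app_eq_zero (F.tv i) (by omega)]
          exact Submodule.zero_mem _
      · simp only [fb]
        rw [pow_add_app]
        by_cases h : (k : ℕ) + j < n i
        · apply Submodule.subset_span
          exact ⟨⟨i, .inr ⟨k, by omega⟩⟩, by simp [f, fb, add_comm]⟩
        · rw [pow_app_eq_zero (F.tw i) (by omega)]
          exact Submodule.zero_mem _
  rw [← hspan, finrank_span_eq_card hli]
  simp

end iso

end FormMod

namespace FormMod

section comb

open Classical in
/-- Number of blocks with given parameters. -/
noncomputable def cnt {ι : Type} [Fintype ι] (p n : ι → ℕ) (s t : ℕ) : ℕ :=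
  ∑ i, if p i = s ∧ n i = t then 1 else 0

lemma cnt_rec {ι : Type} [Fintype ι] (p n : ι → ℕ)
    (hp : ∀ i, p i = n i ∨ p i = n i + 1) (j : ℕ) :
    ∑ i, ((p i - j) + (n i - j)) + ∑ i, ((p i - (j + 2)) + (n i - (j + 2))) =
      2 * ∑ i, ((p i - (j + 1)) + (n i - (j + 1))) + 2 * cnt p n (j + 1) (j + 1) +
        cnt p n (j + 1) j + cnt p n (j + 2) (j + 1) := by
  unfold cnt
  rw [Finset.mul_sum, Finset.mul_sum, ← Finset.sum_add_distrib, ← Finset.sum_add_distrib,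
    ← Finset.sum_add_distrib, ← Finset.sum_add_distrib]
  apply Finset.sum_congr rfl
  intro i _
  have := hp i
  split_ifs <;> omega

lemma cnt_le_one {ι : Type} [Fintype ι] (p n : ι → ℕ)
    (hD : ∀ i j, p i = n i + 1 → p j = n j + 1 → i = j) (s : ℕ) :
    cnt p n (s + 1) s ≤ 1 := by
  unfold cnt
  rw [← Finset.card_filter, Finset.card_le_one]
  intro a ha b hb
  simp only [Finset.mem_filter, Finset.mem_univ, true_and] at ha hb
  exact hD a b (by omega) (by omega)

lemma cnt_eq_zero {ι : Type} [Fintype ι] (p n : ι → ℕ) (s t : ℕ)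
    (h : ∀ i, ¬ (p i = s ∧ n i = t)) : cnt p n s t = 0 := by
  unfold cnt
  apply Finset.sum_eq_zero
  intro i _
  rw [if_neg (h i)]

lemma comb {ι ι' : Type} [Fintype ι] [Fintype ι'] (p n : ι → ℕ) (p' n' : ι' → ℕ)
    (hp : ∀ i, p i = n i ∨ p i = n i + 1) (hp1 : ∀ i, 1 ≤ p i)
    (hD : ∀ i j, p i = n i + 1 → p j = n j + 1 → i = j)
    (hp' : ∀ i, p' i = n' i ∨ p' i = n' i + 1) (hp1' : ∀ i, 1 ≤ p' i)
    (hD' : ∀ i j, p' i = n' i + 1 → p' j = n' j + 1 → i = j)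
    (h : ∀ j, ∑ i, ((p i - j) + (n i - j)) = ∑ i, ((p' i - j) + (n' i - j))) :
    ∃ e : ι ≃ ι', p' ∘ e = p ∧ n' ∘ e = n := by
  classical
  have hd : ∀ m s, ∑ i, p i + ∑ i, p' i ≤ s + m →
      cnt p n (s + 1) s = cnt p' n' (s + 1) s := by
    intro m
    induction m with
    | zero =>
      intro s hs
      rw [cnt_eq_zero, cnt_eq_zero]
      · rintro i ⟨h1, -⟩
        have := Finset.single_le_sum (f := p') (fun _ _ => Nat.zero_le _) (Finset.mem_univ i)
        omega
      · rintro i ⟨h1, -⟩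
        have := Finset.single_le_sum (f := p) (fun _ _ => Nat.zero_le _) (Finset.mem_univ i)
        omega
    | succ m ih =>
      intro s hs
      have h1 : cnt p n (s + 2) (s + 1) = cnt p' n' (s + 2) (s + 1) := ih (s + 1) (by omega)
      have h2 := cnt_rec p n hp s
      have h3 := cnt_rec p' n' hp' s
      rw [h, h, h] at h2
      have h4 := cnt_le_one p n hD s
      have h5 := cnt_le_one p' n' hD' s
      omega
  have hd' : ∀ s, cnt p n (s + 1) s = cnt p' n' (s + 1) s := fun s => hd _ s (Nat.le_add_left _ _)
  have ha : ∀ s, cnt p n s s = cnt p' n' s s := by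
    intro s
    rcases s with _ | s
    · rw [cnt_eq_zero, cnt_eq_zero]
      · rintro i ⟨h1, -⟩
        have := hp1' i
        omega
      · rintro i ⟨h1, -⟩
        have := hp1 i
        omega
    · have h1 : cnt p n (s + 2) (s + 1) = cnt p' n' (s + 2) (s + 1) := hd' (s + 1)
      have h0 := hd' s
      have h2 := cnt_rec p n hp s
      have h3 := cnt_rec p' n' hp' s
      rw [h, h, h] at h2
      omega
  have hall : ∀ s t, cnt p n s t = cnt p' n' s t := by
    intro s t
    by_cases h1 : s = t
    · subst h1; exact ha s
    by_cases h2 : s = t + 1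
    · subst h2; exact hd' t
    rw [cnt_eq_zero, cnt_eq_zero]
    · rintro i ⟨rfl, rfl⟩
      have := hp' i
      omega
    · rintro i ⟨rfl, rfl⟩
      have := hp i
      omega
  let f : ι → ℕ × ℕ := fun i => (p i, n i)
  let f' : ι' → ℕ × ℕ := fun i => (p' i, n' i)
  have hc : ∀ y, Nonempty ({i // f i = y} ≃ {i // f' i = y}) := by
    rintro ⟨s, t⟩
    rw [← Fintype.card_eq, Fintype.card_subtype, Fintype.card_subtype]
    have := hall s t
    unfold cnt at this
    rw [← Finset.card_filter, ← Finset.card_filter] at this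
    simp only [f, f', Prod.mk.injEq]
    convert this
  choose e he using fun y => (⟨(hc y).some, trivial⟩ : ∃ _ : {i // f i = y} ≃ {i // f' i = y}, True)
  let E : ι ≃ ι' := (Equiv.sigmaFiberEquiv f).symm.trans
    ((Equiv.sigmaCongrRight e).trans (Equiv.sigmaFiberEquiv f'))
  have hE : ∀ i, f' (E i) = f i := by
    intro i
    exact (e (f i) ⟨i, rfl⟩).2
  refine ⟨E, ?_, ?_⟩
  · funext i; exact congrArg Prod.fst (hE i)
  · funext i; exact congrArg Prod.snd (hE i)

end comb

section final

variable {K V V' : Type*} [Field K] [AddCommGroup V] [Module K V] [AddCommGroup V'] [Module K V']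
  [IsAlgClosed K] [CharP K 2] [FiniteDimensional K V] [FiniteDimensional K V']
  {Q : QuadraticForm K V} {T : Module.End K V} {Q' : QuadraticForm K V'} {T' : Module.End K V'}

lemma rank_eq (hT : IsNilpotent T) (hT' : IsNilpotent T')
    (h : ∀ j : ℕ, finrank K (LinearMap.ker (T ^ j)) = finrank K (LinearMap.ker (T' ^ j))) (j : ℕ) :
    finrank K (LinearMap.range (T ^ j)) = finrank K (LinearMap.range (T' ^ j)) := by
  obtain ⟨N, hN⟩ := hT
  obtain ⟨N', hN'⟩ := hT'
  have h0 := h (N + N')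
  rw [pow_add, hN, zero_mul, pow_add T', hN', mul_zero, LinearMap.ker_zero, LinearMap.ker_zero,
    finrank_top, finrank_top] at h0
  have h1 := LinearMap.finrank_range_add_finrank_ker (T ^ j)
  have h2 := LinearMap.finrank_range_add_finrank_ker (T' ^ j)
  have h3 := h j
  omega

lemma iso_of_eq (hQ : Q.IsNondegenerateFormSpace) (hT : Q.mem_oLie T) (hTnil : IsNilpotent T)
    (hQ' : Q'.IsNondegenerateFormSpace) (hT' : Q'.mem_oLie T') (hT'nil : IsNilpotent T')
    (h : ∀ j : ℕ, finrank K (LinearMap.ker (T ^ j)) = finrank K (LinearMap.ker (T' ^ j)))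
    (hchi : ∀ m : ℕ, Q.indexChi T m = Q'.indexChi T' m) :
    ∃ g : V ≃ₗ[K] V', (∀ v : V, Q' (g v) = Q v) ∧ ∀ v : V, g (T v) = T' (g v) := by
  have hA : Alt Q T := fun v => by simpa [Bf] using hT.1 v
  have hA' : Alt Q' T' := fun v => by simpa [Bf] using hT'.1 v
  obtain ⟨ι, _, v, w, p, n, l, F, hs, hl⟩ := normal_form hA hTnil hQ
  obtain ⟨ι', _, v', w', p', n', l', F', hs', hl'⟩ := normal_form hA' hT'nil hQ'
  obtain ⟨e, he1, he2⟩ := comb p n p' n' F.hp F.hp1 F.hD F'.hp F'.hp1 F'.hD (fun j => by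
    rw [← F.rank hA hs, ← F'.rank hA' hs']
    exact rank_eq hTnil hT'nil h j)
  have he3 : l' ∘ e = l := by
    funext i
    have h1 : p' (e i) = p i := congrFun he1 i
    have h2 : n' (e i) = n i := congrFun he2 i
    show l' (e i) = l i
    rcases F.hp i with h3 | h3
    · rw [hl i h3, hl' (e i) (by omega), h2, hchi]
    · rw [F.hl i h3, F'.hl (e i) (by omega), h1]
  have F2 := F'.reindex e
  rw [he1, he2, he3] at F2
  refine F.iso hA hs hA' F2 ?_
  have h0 := rank_eq hTnil hT'nil h 0
  rw [F.rank hA hs, F'.rank hA' hs'] at h0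
  simp only [Nat.sub_zero] at h0
  rw [h0, hs']

lemma chi_eq_of_iso (g : V ≃ₗ[K] V') (h1 : ∀ v : V, Q' (g v) = Q v)
    (h2 : ∀ v : V, g (T v) = T' (g v)) :
    (∀ j : ℕ, finrank K (LinearMap.ker (T ^ j)) = finrank K (LinearMap.ker (T' ^ j))) ∧
      ∀ m : ℕ, Q.indexChi T m = Q'.indexChi T' m := by
  have hk : ∀ (k : ℕ) (x : V), g ((T ^ k) x) = (T' ^ k) (g x) := by
    intro k
    induction k with
    | zero => intro x; simp
    | succ k ih => intro x; rw [pow_succ_app, ih, h2, pow_succ_app]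
  constructor
  · intro j
    have : (LinearMap.ker (T ^ j)).map g.toLinearMap = LinearMap.ker (T' ^ j) := by
      ext y
      constructor
      · rintro ⟨x, hx, rfl⟩
        have hx' : (T ^ j) x = 0 := hx
        show (T' ^ j) (g x) = 0
        rw [← hk, hx', map_zero]
      · intro hy
        refine ⟨g.symm y, ?_, g.apply_symm_apply y⟩
        show (T ^ j) (g.symm y) = 0
        apply g.injective
        rw [hk, g.apply_symm_apply, map_zero]
        exact hy
    rw [← this]
    exact (LinearEquiv.finrank_map_eq g _).symm
  · intro m
    unfold QuadraticForm.indexChi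
    congr 1
    ext j
    constructor
    · intro h y hy
      obtain ⟨x, rfl⟩ := g.surjective y
      rw [← hk] at hy ⊢
      rw [h1]
      exact h x (g.injective (by rw [hy, map_zero]))
    · intro h x hx
      rw [← h1, hk]
      apply h
      rw [← hk, hx, map_zero]

end final

end FormMod

/-- Over an algebraically closed field `K` of characteristic 2, two non-degenerate form
modules `(V, T)` and `(V', T')` are isomorphic (by a linear isometry intertwining the
nilpotent operators) if and only if `T` and `T'` have the same Jordan type (equivalently,
`dim ker T^j = dim ker T'^j` for all `j`) and the index functions agree. -/
theorem form_module_iso_iff_jordan_type_and_index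
    (K : Type*) [Field K] [IsAlgClosed K] [CharP K 2]
    (V : Type*) [AddCommGroup V] [Module K V] [FiniteDimensional K V]
    (V' : Type*) [AddCommGroup V'] [Module K V'] [FiniteDimensional K V']
    (Q : QuadraticForm K V) (T : Module.End K V)
    (Q' : QuadraticForm K V') (T' : Module.End K V')
    (hQ : Q.IsNondegenerateFormSpace) (hT : Q.mem_oLie T) (hTnil : IsNilpotent T)
    (hQ' : Q'.IsNondegenerateFormSpace) (hT' : Q'.mem_oLie T') (hT'nil : IsNilpotent T') :
    (∃ g : V ≃ₗ[K] V', (∀ v : V, Q' (g v) = Q v) ∧ ∀ v : V, g (T v) = T' (g v)) ↔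
      ((∀ j : ℕ, Module.finrank K (LinearMap.ker (T ^ j)) =
          Module.finrank K (LinearMap.ker (T' ^ j))) ∧
        ∀ m : ℕ, Q.indexChi T m = Q'.indexChi T' m) := by
  constructor
  · rintro ⟨g, h1, h2⟩
    exact FormMod.chi_eq_of_iso g h1 h2
  · rintro ⟨h1, h2⟩
    exact FormMod.iso_of_eq hQ hT hTnil hQ' hT' hT'nil h1 h2
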